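/- arXiv:1112.1233 — 3 statements merged into one kernel-verified Lean document; each statement's English description precedes it below -/
import Mathlib

section
/- Let ψ : ℝ₊ × K* → V be any map satisfying: (a) ψ(0,u) = u and ψ(t,u) ∈ K* for all t ≥ 0 and u ∈ K*; (b) the semi-flow property ψ(t+s,u) = ψ(s,ψ(t,u)) for all s,t ≥ 0 and u ∈ K*; (c) ψ is jointly continuous on ℝ₊ × K* and, for each t ≥ 0, the map u ↦ ψ(t,u) is real-analytic on K̊*; (d) ψ is order preserving: u ⪯ v implies ψ(t,u) ⪯ ψ(t,v) for all t ≥ 0 and u,v ∈ K*. Then ψ(t,u) ∈ K̊* for all t ≥ 0 and all u ∈ K̊*. -/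
open MeasureTheory Filter Set
open scoped RealInnerProductSpace ENNReal Topology

/-- The closed dual cone of a set `K`. -/
def dualCone {V : Type*} [NormedAddCommGroup V] [InnerProductSpace ℝ V]
    (K : Set V) : Set V := {u | ∀ x ∈ K, 0 ≤ ⟪x, u⟫}

/-- `K` is a proper (pointed) generating closed convex cone. -/
structure IsProperConvexCone {V : Type*} [NormedAddCommGroup V] [InnerProductSpace ℝ V]
    (K : Set V) : Prop where
  isClosed : IsClosed K
  convex : Convex ℝ K
  smul_mem : ∀ (c : ℝ), 0 ≤ c → ∀ x ∈ K, c • x ∈ K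
  proper : K ∩ (-K) = {0}
  generating : ∀ v : V, ∃ x ∈ K, ∃ y ∈ K, v = x - y

theorem dc_convex {V : Type*} [NormedAddCommGroup V] [InnerProductSpace ℝ V]
    (K : Set V) : Convex ℝ (dualCone K) := by
  intro a ha b hb p q hp hq _ x hx
  rw [inner_add_right, inner_smul_right, inner_smul_right]
  have := mul_nonneg hp (ha x hx)
  have := mul_nonneg hq (hb x hx)
  linarith

theorem dc_zero {V : Type*} [NormedAddCommGroup V] [InnerProductSpace ℝ V]
    (K : Set V) : (0 : V) ∈ dualCone K := by
  intro x _
  simp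

theorem dc_half {V : Type*} [NormedAddCommGroup V] [InnerProductSpace ℝ V]
    (K : Set V) (v : V) (hv : v ∈ interior (dualCone K)) :
    (1 / 2 : ℝ) • v ∈ interior (dualCone K) := by
  have := (dc_convex K).combo_interior_self_mem_interior hv (dc_zero K)
    (a := 1 / 2) (b := 1 / 2) (by norm_num) (by norm_num) (by norm_num)
  simpa using this

theorem dc_sep {V : Type*} [NormedAddCommGroup V] [InnerProductSpace ℝ V]
    (K : Set V) (u w : V) (hu : u ∈ interior (dualCone K)) (hw : w ∈ dualCone K)
    (hwi : w ∉ interior (dualCone K)) :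
    ∃ f : StrongDual ℝ V, (∀ a ∈ dualCone K, f a ≤ 0) ∧ f w = 0 ∧
      ∀ a ∈ interior (dualCone K), f a < 0 := by
  obtain ⟨f, hf⟩ := geometric_hahn_banach_open_point (dc_convex K).interior isOpen_interior hwi
  have h1 : ∀ a ∈ dualCone K, f a ≤ f w := by
    intro a ha
    have hc : a ∈ closure (interior (dualCone K)) := by
      rw [(dc_convex K).closure_interior_eq_closure_of_nonempty_interior ⟨u, hu⟩]
      exact subset_closure ha
    have hcl : IsClosed {a | f a ≤ f w} := isClosed_le f.continuous continuous_const
    exact closure_minimal (fun b hb => (hf b hb).le) hcl hc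
  have h2 := h1 0 (dc_zero K)
  have h3 := h1 ((2 : ℝ) • w) (by
    intro x hx
    rw [inner_smul_right]
    exact mul_nonneg (by norm_num) (hw x hx))
  simp only [map_zero, map_smul, smul_eq_mul] at h2 h3
  have h4 : f w = 0 := by linarith
  rw [h4] at h1 hf
  exact ⟨f, h1, h4, hf⟩

theorem dc_step {V : Type*} [NormedAddCommGroup V] [InnerProductSpace ℝ V]
    (K : Set V) (g : V → V) (hrange : ∀ u ∈ dualCone K, g u ∈ dualCone K)
    (hanal : AnalyticOnNhd ℝ g (interior (dualCone K)))
    (hmono : ∀ u ∈ dualCone K, ∀ v ∈ dualCone K, v - u ∈ dualCone K →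
      g v - g u ∈ dualCone K) (u v : V) (hu : u ∈ interior (dualCone K))
    (hv : v ∈ interior (dualCone K)) (hgu : g u ∈ interior (dualCone K)) :
    g v ∈ interior (dualCone K) := by
  by_contra hcon
  obtain ⟨f, hf, hfv, hfi⟩ := dc_sep K u (g v) hu (hrange v (interior_subset hv)) hcon
  have hh := dc_half K v hv
  have han : AnalyticOnNhd ℝ (fun a => f (g a)) (interior (dualCone K)) :=
    f.comp_analyticOnNhd hanal
  have hev : (fun a => f (g a)) =ᶠ[𝓝 ((1 / 2 : ℝ) • v)] 0 := by
    have e1 : ∀ᶠ a in 𝓝 ((1 / 2 : ℝ) • v), a ∈ interior (dualCone K) :=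
      isOpen_interior.mem_nhds hh
    have e2 : ∀ᶠ a in 𝓝 ((1 / 2 : ℝ) • v), v - a ∈ interior (dualCone K) := by
      have hc : Continuous (fun a : V => v - a) := by fun_prop
      apply hc.continuousAt.eventually_mem
      apply isOpen_interior.mem_nhds
      have : v - (1 / 2 : ℝ) • v = (1 / 2 : ℝ) • v := by module
      rw [this]
      exact hh
    filter_upwards [e1, e2] with a h1 h2
    have h3 := hf _ (hrange a (interior_subset h1))
    have h4 := hf _ (hmono a (interior_subset h1) v (interior_subset hv) (interior_subset h2))
    rw [map_sub, hfv] at h4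
    simp only [Pi.zero_apply]
    linarith
  have := han.eqOn_zero_of_preconnected_of_eventuallyEq_zero
    (dc_convex K).interior.isPreconnected hh hev hu
  have h5 := hfi _ hgu
  simp only [Pi.zero_apply] at this
  linarith

/-- If `ψ : ℝ₊ × K* → V` satisfies `ψ(0,u) = u`, takes values in `K*`,
has the semi-flow property, is jointly continuous on `ℝ₊ × K*`, is real-analytic in
`u` on the interior of `K*` for each fixed `t ≥ 0`, and is order preserving, then
`ψ(t,u)` lies in the interior of `K*` for all `t ≥ 0` and `u` in the interior of `K*`. -/
theorem psi_maps_interior_to_interior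
    {V : Type*} [NormedAddCommGroup V] [InnerProductSpace ℝ V] [FiniteDimensional ℝ V]
    (K : Set V) (hK : IsProperConvexCone K) (ψ : ℝ → V → V)
    (h0 : ∀ u ∈ dualCone K, ψ 0 u = u)
    (hrange : ∀ t : ℝ, 0 ≤ t → ∀ u ∈ dualCone K, ψ t u ∈ dualCone K)
    (hflow : ∀ s t : ℝ, 0 ≤ s → 0 ≤ t → ∀ u ∈ dualCone K, ψ (t + s) u = ψ s (ψ t u))
    (hcont : ContinuousOn (fun q : ℝ × V => ψ q.1 q.2) (Set.Ici (0 : ℝ) ×ˢ dualCone K))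
    (hanal : ∀ t : ℝ, 0 ≤ t → AnalyticOnNhd ℝ (ψ t) (interior (dualCone K)))
    (hmono : ∀ t : ℝ, 0 ≤ t → ∀ u ∈ dualCone K, ∀ v ∈ dualCone K, v - u ∈ dualCone K →
      ψ t v - ψ t u ∈ dualCone K) :
    ∀ t : ℝ, 0 ≤ t → ∀ u ∈ interior (dualCone K), ψ t u ∈ interior (dualCone K) := by
  intro t ht u hu
  have huK := interior_subset hu
  have hev : ∀ᶠ s in 𝓝[Set.Ici 0] (0 : ℝ), ψ s u ∈ interior (dualCone K) := by
    have hc : ContinuousOn (fun s : ℝ => ψ s u) (Set.Ici 0) :=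
      hcont.comp (f := fun s : ℝ => (s, u)) (by fun_prop) (fun s hs => ⟨hs, huK⟩)
    apply (hc 0 (by simp)).eventually_mem
    apply isOpen_interior.mem_nhds
    simpa only [h0 u huK] using hu
  obtain ⟨δ, hδ, hball⟩ := Metric.mem_nhdsWithin_iff.1 hev
  obtain ⟨n, hn⟩ := exists_nat_gt (t / δ)
  have hn0 : (0 : ℝ) < n := lt_of_le_of_lt (div_nonneg ht hδ.le) hn
  have hr0 : 0 ≤ t / n := div_nonneg ht hn0.le
  have hrδ : t / n < δ := by
    rw [div_lt_iff₀ hδ] at hn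
    rw [div_lt_iff₀ hn0]
    linarith
  have hr : ψ (t / n) u ∈ interior (dualCone K) := by
    apply hball
    refine ⟨?_, hr0⟩
    rw [Metric.mem_ball, Real.dist_eq, sub_zero, abs_of_nonneg hr0]
    exact hrδ
  have key : ∀ m : ℕ, ψ (m * (t / n)) u ∈ interior (dualCone K) := by
    intro m
    induction m with
    | zero => simpa [h0 u huK] using hu
    | succ k ih =>
      have e : ((k + 1 : ℕ) : ℝ) * (t / n) = k * (t / n) + t / n := by push_cast; ring
      rw [e, hflow _ _ hr0 (by positivity) u huK]
      exact dc_step K _ (hrange _ hr0) (hanal _ hr0) (hmono _ hr0) u _ hu ih hr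
  have := key n
  rwa [mul_div_cancel₀ _ hn0.ne'] at this
end

section
/- Let (ν_n) be a sequence of Borel measures on V such that L_n(u) := ∫_V e^{−⟨u,ξ⟩} ν_n(dξ) < ∞ for all u ∈ K̊* ∪ {0} and L_n(u) → L(u) pointwise on K̊* ∪ {0} for some finite function L that is continuous at u = 0. Then there exists a finite Borel measure ν on V such that: ν_n converges weakly to ν (i.e. ∫ f dν_n → ∫ f dν for every bounded continuous f : V → ℝ); for every u ∈ K̊* ∪ {0} and v ∈ V, ∫_V e^{−⟨u,ξ⟩} e^{−i⟨v,ξ⟩} ν_n(dξ) → ∫_V e^{−⟨u,ξ⟩} e^{−i⟨v,ξ⟩} ν(dξ); ν(V) = lim_n ν_n(V); and L(u) = ∫_V e^{−⟨u,ξ⟩} ν(dξ) for all u ∈ K̊* ∪ {0}. -/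
open MeasureTheory Filter Set
open scoped RealInnerProductSpace ENNReal Topology

lemma cone_interior_nonempty
    {V : Type*} [NormedAddCommGroup V] [InnerProductSpace ℝ V] [FiniteDimensional ℝ V]
    (K : Set V) (hK : IsProperConvexCone K) : (interior (dualCone K)).Nonempty := by
  have h0 : (0 : V) ∈ K := by
    have : (0 : V) ∈ K ∩ (-K) := by rw [hK.proper]; rfl
    exact this.1
  have hadd : ∀ x ∈ K, ∀ y ∈ K, x + y ∈ K := by
    intro x hx y hy
    have h := hK.convex hx hy (by norm_num : (0:ℝ) ≤ 1/2) (by norm_num : (0:ℝ) ≤ 1/2) (by norm_num)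
    have h2 := hK.smul_mem 2 (by norm_num) _ h
    simpa [smul_add, smul_smul] using h2
  let C : ProperCone ℝ V :=
    { carrier := K
      add_mem' := fun {a b} ha hb => hadd a ha b hb
      zero_mem' := h0
      smul_mem' := fun c x hx => hK.smul_mem c.1 c.2 x hx
      isClosed' := hK.isClosed }
  have hbi : ∀ x : V, (∀ y ∈ dualCone K, 0 ≤ ⟪x, y⟫) → x ∈ K := by
    intro x hx
    by_contra hxK
    obtain ⟨y, hy1, hy2⟩ := C.hyperplane_separation' (x₀ := x) hxK
    exact absurd (hx y hy1) (not_le.mpr hy2)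
  have hconv : Convex ℝ (dualCone K) := by
    intro x hx y hy a b ha hb _ z hz
    rw [inner_add_right, inner_smul_right, inner_smul_right]
    have := hx z hz
    have := hy z hz
    positivity
  have hz : (0 : V) ∈ dualCone K := fun x _ => by simp
  rw [hconv.interior_nonempty_iff_affineSpan_eq_top]
  have hspan : Submodule.span ℝ (dualCone K) = ⊤ := by
    rw [← Submodule.orthogonal_eq_bot_iff, Submodule.eq_bot_iff]
    intro x hx
    rw [Submodule.mem_orthogonal] at hx
    have e : ∀ y ∈ dualCone K, ⟪x, y⟫ = 0 := fun y hy => by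
      rw [real_inner_comm]; exact hx y (Submodule.subset_span hy)
    have : x ∈ K ∩ (-K) := by
      refine ⟨hbi x fun y hy => (e y hy).ge, hbi (-x) fun y hy => ?_⟩
      rw [inner_neg_left, e y hy]; simp
    rw [hK.proper] at this
    exact this
  apply SetLike.coe_injective
  rw [← Set.insert_eq_of_mem hz, affineSpan_insert_zero, hspan]
  rfl

open scoped Pointwise in
lemma smul_mem_interior_dual
    {V : Type*} [NormedAddCommGroup V] [InnerProductSpace ℝ V]
    (K : Set V) {t : ℝ} (ht : 0 < t) {u : V} (hu : u ∈ interior (dualCone K)) :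
    t • u ∈ interior (dualCone K) := by
  have h : t • u ∈ interior (t • dualCone K) := by
    rw [interior_smul₀ ht.ne']
    exact Set.smul_mem_smul_set hu
  refine interior_mono ?_ h
  rintro _ ⟨y, hy, rfl⟩ z hz
  simp only [inner_smul_right]
  exact mul_nonneg ht.le (hy z hz)

lemma weak_lsc {V : Type*} [TopologicalSpace V] [MeasurableSpace V] [BorelSpace V]
    {ι : Type*} {F : Filter ι} [F.NeBot] (m : ι → Measure V) (μ : Measure V)
    [∀ i, IsFiniteMeasure (m i)] [IsFiniteMeasure μ]
    (hw : ∀ f : BoundedContinuousFunction V ℝ,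
        Tendsto (fun n => ∫ ξ, f ξ ∂(m n)) F (nhds (∫ ξ, f ξ ∂μ)))
    (g : V → ℝ) (hg : Continuous g) (hg0 : ∀ x, 0 ≤ g x) (B : ℝ)
    (hint : ∀ i, Integrable g (m i)) (hB : ∀ i, ∫ x, g x ∂(m i) ≤ B) :
    Integrable g μ ∧ ∫ x, g x ∂μ ≤ B := by
  let f : ℕ → BoundedContinuousFunction V ℝ := fun M =>
    BoundedContinuousFunction.ofNormedAddCommGroup (fun x => min (g x) M)
      (by fun_prop) M (fun x => by
        rw [Real.norm_of_nonneg (le_min (hg0 x) (Nat.cast_nonneg M))]; exact min_le_right _ _)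
  have hfx : ∀ M x, f M x = min (g x) M := fun _ _ => rfl
  have h1 : ∀ M : ℕ, ∫ x, f M x ∂μ ≤ B := fun M => by
    refine le_of_tendsto (hw (f M)) (Eventually.of_forall fun i => ?_)
    refine le_trans (integral_mono ((f M).integrable _) (hint i) fun x => ?_) (hB i)
    exact min_le_left _ _
  have hB0 : 0 ≤ B := by
    have := h1 0
    simp [hfx, hg0] at this
    exact this
  have h2 : ∫⁻ x, ENNReal.ofReal (g x) ∂μ ≤ ENNReal.ofReal B := by
    have e : ∀ x, ENNReal.ofReal (g x) = ⨆ M : ℕ, ENNReal.ofReal (f M x) := by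
      intro x
      apply le_antisymm
      · obtain ⟨M, hM⟩ := exists_nat_ge (g x)
        refine le_iSup_of_le M ?_
        rw [hfx, min_eq_left hM]
      · exact iSup_le fun M => ENNReal.ofReal_le_ofReal (min_le_left _ _)
    simp_rw [e]
    rw [lintegral_iSup]
    · refine iSup_le fun M => ?_
      rw [← ofReal_integral_eq_lintegral_ofReal ((f M).integrable _)
        (Eventually.of_forall fun x => le_min (hg0 x) (Nat.cast_nonneg M))]
      exact ENNReal.ofReal_le_ofReal (h1 M)
    · intro M
      exact ((f M).continuous.measurable).ennreal_ofReal
    · intro M N h x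
      apply ENNReal.ofReal_le_ofReal
      rw [hfx, hfx]
      exact min_le_min le_rfl (by exact_mod_cast h)
  have hI : Integrable g μ := by
    refine ⟨hg.measurable.aestronglyMeasurable, ?_⟩
    rw [hasFiniteIntegral_iff_ofReal (Eventually.of_forall hg0)]
    exact h2.trans_lt ENNReal.ofReal_lt_top
  refine ⟨hI, ?_⟩
  rw [← ofReal_integral_eq_lintegral_ofReal hI (Eventually.of_forall hg0)] at h2
  exact (ENNReal.ofReal_le_ofReal_iff hB0).1 h2

lemma weak_unif {V : Type*} [TopologicalSpace V] [MeasurableSpace V] [BorelSpace V]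
    {ι : Type*} {F : Filter ι} [F.NeBot] (m : ι → Measure V) (μ : Measure V)
    [∀ i, IsFiniteMeasure (m i)] [IsFiniteMeasure μ]
    (hw : ∀ f : BoundedContinuousFunction V ℝ,
        Tendsto (fun n => ∫ ξ, f ξ ∂(m n)) F (nhds (∫ ξ, f ξ ∂μ)))
    (g : V → ℝ) (hg : Continuous g) (hg0 : ∀ x, 0 ≤ g x) (B : ℝ)
    (hint1 : ∀ i, Integrable g (m i))
    (hint : ∀ i, Integrable (fun x => g x ^ 2) (m i)) (hB : ∀ i, ∫ x, g x ^ 2 ∂(m i) ≤ B)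
    (φ : V → ℝ) (hφ : Continuous φ) (hφ1 : ∀ x, |φ x| ≤ 1) :
    Integrable g μ ∧
      Tendsto (fun n => ∫ ξ, g ξ * φ ξ ∂(m n)) F (nhds (∫ ξ, g ξ * φ ξ ∂μ)) := by
  obtain ⟨hI2, hB2⟩ := weak_lsc m μ hw (fun x => g x ^ 2) (by fun_prop)
    (fun x => sq_nonneg _) B hint hB
  have hI : Integrable g μ := by
    refine Integrable.mono' (hI2.add (integrable_const (1:ℝ))) hg.measurable.aestronglyMeasurable
      (Eventually.of_forall fun x => ?_)
    rw [Real.norm_of_nonneg (hg0 x)]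
    simp only [Pi.add_apply]
    nlinarith [sq_nonneg (g x - 1), hg0 x]
  refine ⟨hI, ?_⟩
  have hB0 : 0 ≤ B := le_trans (integral_nonneg fun x => sq_nonneg _) hB2
  -- truncation error
  have key : ∀ (κ : Measure V) [IsFiniteMeasure κ], Integrable g κ →
      Integrable (fun x => g x ^ 2) κ → ∫ x, g x ^ 2 ∂κ ≤ B → ∀ M : ℝ, 0 < M →
      dist (∫ x, g x * φ x ∂κ) (∫ x, min (g x) M * φ x ∂κ) ≤ B / M := by
    intro κ _ hk1 hk2 hk3 M hM
    have i1 : Integrable (fun x => g x * φ x) κ := by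
      refine Integrable.mono' hk1 (by fun_prop) (Eventually.of_forall fun x => ?_)
      rw [norm_mul, Real.norm_of_nonneg (hg0 x), Real.norm_eq_abs]
      exact mul_le_of_le_one_right (hg0 x) (hφ1 x)
    have i2 : Integrable (fun x => min (g x) M * φ x) κ := by
      refine Integrable.mono' hk1 (by fun_prop) (Eventually.of_forall fun x => ?_)
      rw [norm_mul, Real.norm_of_nonneg (le_min (hg0 x) hM.le), Real.norm_eq_abs]
      exact (mul_le_of_le_one_right (le_min (hg0 x) hM.le) (hφ1 x)).trans (min_le_left _ _)
    rw [dist_eq_norm, ← integral_sub i1 i2]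
    have : ∫ x, g x ^ 2 / M ∂κ ≤ B / M := by
      rw [integral_div]; gcongr
    refine le_trans (norm_integral_le_of_norm_le (hk2.div_const M)
      (Eventually.of_forall fun x => ?_)) this
    rw [← sub_mul, norm_mul, Real.norm_of_nonneg (sub_nonneg.2 (min_le_left _ _)), Real.norm_eq_abs]
    refine (mul_le_of_le_one_right (sub_nonneg.2 (min_le_left _ _)) (hφ1 x)).trans ?_
    rw [le_div_iff₀ hM]
    rcases le_total (g x) M with h | h
    · rw [min_eq_left h]; simp; positivity
    · rw [min_eq_right h]; nlinarith [hg0 x]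
  rw [Metric.tendsto_nhds]
  intro ε hε
  obtain ⟨M, hM, hMB⟩ : ∃ M : ℝ, 0 < M ∧ B / M ≤ ε / 4 := by
    refine ⟨4 * (B + 1) / ε, by positivity, ?_⟩
    rw [div_le_iff₀ (by positivity)]
    field_simp
    linarith
  let f : BoundedContinuousFunction V ℝ :=
    BoundedContinuousFunction.ofNormedAddCommGroup (fun x => min (g x) M * φ x)
      (by fun_prop) M (fun x => by
        rw [norm_mul, Real.norm_of_nonneg (le_min (hg0 x) hM.le), Real.norm_eq_abs]
        exact (mul_le_of_le_one_right (le_min (hg0 x) hM.le) (hφ1 x)).trans (min_le_right _ _))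
  have hf := Metric.tendsto_nhds.1 (hw f) (ε / 4) (by positivity)
  filter_upwards [hf] with i hi
  have a := key (m i) (hint1 i) (hint i) (hB i) M hM
  have b := key μ hI hI2 hB2 M hM
  change dist (∫ x, min (g x) M * φ x ∂(m i)) (∫ x, min (g x) M * φ x ∂μ) < ε / 4 at hi
  rw [dist_comm] at b
  have := dist_triangle4 (∫ x, g x * φ x ∂(m i)) (∫ x, min (g x) M * φ x ∂(m i))
    (∫ x, min (g x) M * φ x ∂μ) (∫ x, g x * φ x ∂μ)
  linarith

lemma laplace_unique {V : Type*} [NormedAddCommGroup V] [InnerProductSpace ℝ V]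
    [FiniteDimensional ℝ V] [MeasurableSpace V] [BorelSpace V]
    (μ₁ μ₂ : Measure V) [IsFiniteMeasure μ₁] [IsFiniteMeasure μ₂] (U : Set V) (hU : IsOpen U)
    (e : V) (he : e ∈ U)
    (h1 : ∀ u ∈ U, Integrable (fun ξ => Real.exp (-⟪u, ξ⟫)) μ₁)
    (h2 : ∀ u ∈ U, Integrable (fun ξ => Real.exp (-⟪u, ξ⟫)) μ₂)
    (heq : ∀ u ∈ U, ∫ ξ, Real.exp (-⟪u, ξ⟫) ∂μ₁ = ∫ ξ, Real.exp (-⟪u, ξ⟫) ∂μ₂) : μ₁ = μ₂ := by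
  let d : V → ℝ≥0∞ := fun ξ => ENNReal.ofReal (Real.exp (-⟪e, ξ⟫))
  have hd : Measurable d := by fun_prop
  have hd0 : ∀ ξ, d ξ ≠ 0 := fun ξ => by simp [d, Real.exp_pos]
  have hdt : ∀ ξ, d ξ ≠ ∞ := fun ξ => by simp [d]
  have fin : ∀ κ : Measure V, Integrable (fun ξ => Real.exp (-⟪e, ξ⟫)) κ →
      IsFiniteMeasure (κ.withDensity d) := fun κ hκ =>
    isFiniteMeasure_withDensity_ofReal hκ.2
  have := fin μ₁ (h1 e he)
  have := fin μ₂ (h2 e he)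
  have tr : ∀ (κ : Measure V) (v : V) (t : ℝ) (ξ : V),
      (d ξ).toReal * Real.exp (t * ⟪v, ξ⟫) = Real.exp (-⟪e - t • v, ξ⟫) := by
    intro κ v t ξ
    simp only [d]
    rw [ENNReal.toReal_ofReal (Real.exp_pos _).le, ← Real.exp_add, inner_sub_left,
      real_inner_smul_left]
    congr 1; ring
  have iexp : ∀ κ : Measure V, (∀ u ∈ U, Integrable (fun ξ => Real.exp (-⟪u, ξ⟫)) κ) →
      ∀ v : V, ∀ t : ℝ, e - t • v ∈ U →
      t ∈ ProbabilityTheory.integrableExpSet (fun ξ => ⟪v, ξ⟫) (κ.withDensity d) := by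
    intro κ hκ v t ht
    have := hκ _ ht
    simp only [ProbabilityTheory.integrableExpSet, Set.mem_ofPred_eq]
    rw [integrable_withDensity_iff_integrable_smul₀' hd.aemeasurable
      (Eventually.of_forall fun x => (hdt x).lt_top)]
    simpa only [smul_eq_mul, tr κ] using this
  have mg : ∀ κ : Measure V, ∀ v : V, ∀ t : ℝ,
      ProbabilityTheory.mgf (fun ξ => ⟪v, ξ⟫) (κ.withDensity d) t
        = ∫ ξ, Real.exp (-⟪e - t • v, ξ⟫) ∂κ := by
    intro κ v t
    rw [ProbabilityTheory.mgf, integral_withDensity_eq_integral_toReal_smul hd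
      (Eventually.of_forall fun x => (hdt x).lt_top)]
    simp only [smul_eq_mul, tr κ]
  have hmain : μ₁.withDensity d = μ₂.withDensity d := by
    apply Measure.ext_of_charFun
    ext v
    have hopen : ∀ᶠ t : ℝ in 𝓝 0, e - t • v ∈ U := by
      have : Continuous (fun t : ℝ => e - t • v) := by fun_prop
      exact this.continuousAt.eventually_mem (hU.mem_nhds (by simpa using he))
    obtain ⟨δ, hδ, hball⟩ := Metric.eventually_nhds_iff_ball.1 hopen
    have hsub : ∀ κ : Measure V, (∀ u ∈ U, Integrable (fun ξ => Real.exp (-⟪u, ξ⟫)) κ) →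
        Metric.ball (0:ℝ) δ ⊆
          interior (ProbabilityTheory.integrableExpSet (fun ξ => ⟪v, ξ⟫) (κ.withDensity d)) :=
      fun κ hκ => interior_maximal (fun t ht => iexp κ hκ v t (hball t ht)) Metric.isOpen_ball
    have han : ∀ κ : Measure V, (∀ u ∈ U, Integrable (fun ξ => Real.exp (-⟪u, ξ⟫)) κ) →
        AnalyticOnNhd ℂ (ProbabilityTheory.complexMGF (fun ξ => ⟪v, ξ⟫) (κ.withDensity d))
          {z | z.re ∈ Metric.ball (0:ℝ) δ} := fun κ hκ =>
      ProbabilityTheory.analyticOnNhd_complexMGF.mono fun z hz => hsub κ hκ hz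
    have hE : Set.EqOn (ProbabilityTheory.complexMGF (fun ξ => ⟪v, ξ⟫) (μ₁.withDensity d))
        (ProbabilityTheory.complexMGF (fun ξ => ⟪v, ξ⟫) (μ₂.withDensity d))
        {z | z.re ∈ Metric.ball (0:ℝ) δ} := by
      refine AnalyticOnNhd.eqOn_of_preconnected_of_frequently_eq (han μ₁ h1) (han μ₂ h2)
        ((convex_ball (0:ℝ) δ).linear_preimage Complex.reLm).isPreconnected
        (z₀ := ((0:ℝ) : ℂ)) (by simp [hδ]) ?_
      have h_real : ∃ᶠ (x : ℝ) in 𝓝[≠] 0,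
          ProbabilityTheory.complexMGF (fun ξ => ⟪v, ξ⟫) (μ₁.withDensity d) x
          = ProbabilityTheory.complexMGF (fun ξ => ⟪v, ξ⟫) (μ₂.withDensity d) x := by
        apply Eventually.frequently
        filter_upwards [nhdsWithin_le_nhds hopen] with y hy
        rw [ProbabilityTheory.complexMGF_ofReal, ProbabilityTheory.complexMGF_ofReal, mg, mg,
          heq _ hy]
      rw [frequently_iff_seq_forall] at h_real ⊢
      obtain ⟨xs, hx_tendsto, hx_eq⟩ := h_real
      refine ⟨fun n ↦ xs n, ?_, fun n ↦ ?_⟩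
      · rw [tendsto_nhdsWithin_iff] at hx_tendsto ⊢
        constructor
        · exact (Complex.continuous_ofReal.tendsto _).comp hx_tendsto.1
        · simpa using hx_tendsto.2
      · simp [hx_eq]
    have := hE (x := Complex.I) (by simp [hδ])
    simp only [ProbabilityTheory.complexMGF] at this
    simp only [charFun_apply]
    simpa only [mul_comm Complex.I, real_inner_comm] using this
  rw [← withDensity_inv_same (μ := μ₁) hd (Eventually.of_forall hd0) (Eventually.of_forall hdt),
    hmain, withDensity_inv_same hd (Eventually.of_forall hd0) (Eventually.of_forall hdt)]

lemma pt_bound (t x : ℝ) (ht : 0 < t) (ht1 : t ≤ 1) :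
    Set.indicator {y : ℝ | 1 / t < |y|} (fun _ => (1:ℝ)) x
      ≤ 2 * (1 - Real.exp (-(t * x))) + 3 * t * Real.exp (-x) := by
  have hconv : Real.exp (-(t * x)) ≤ (1 - t) + t * Real.exp (-x) := by
    have := convexOn_exp.2 (Set.mem_univ (0:ℝ)) (Set.mem_univ (-x)) (sub_nonneg.2 ht1) ht.le
      (by ring)
    simp only [smul_eq_mul, mul_zero, zero_add, Real.exp_zero, mul_one] at this
    rwa [mul_neg] at this
  have hp := Real.exp_pos (-x)
  have hnn : 0 < t * Real.exp (-x) := by positivity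
  by_cases h : x ∈ {y : ℝ | 1 / t < |y|}
  · rw [Set.indicator_of_mem h]
    rw [Set.mem_ofPred_eq, div_lt_iff₀ ht] at h
    rcases le_total 0 x with hx | hx
    · rw [abs_of_nonneg hx] at h
      have : Real.exp (-(t * x)) ≤ 1 / 2 := by
        have h1 : Real.exp (-(t*x)) ≤ Real.exp (-1) := Real.exp_le_exp.2 (by nlinarith)
        have h2 : Real.exp (-1) ≤ 1 / 2 := by
          rw [Real.exp_neg, inv_eq_one_div]
          apply one_div_le_one_div_of_le (by norm_num)
          linarith [Real.add_one_le_exp (1:ℝ)]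
        linarith
      nlinarith
    · rw [abs_of_nonpos hx] at h
      have := Real.add_one_le_exp (-x)
      have : 1 ≤ t * Real.exp (-x) := by nlinarith
      nlinarith
  · rw [Set.indicator_of_notMem h]
    nlinarith

lemma tail_bound {V : Type*} [NormedAddCommGroup V] [InnerProductSpace ℝ V]
    [FiniteDimensional ℝ V] [MeasurableSpace V] [BorelSpace V]
    (K : Set V) (ν : ℕ → Measure V) (L : V → ℝ) [∀ n, IsFiniteMeasure (ν n)]
    (hint : ∀ n : ℕ, ∀ u ∈ interior (dualCone K) ∪ {0},
      Integrable (fun ξ => Real.exp (-⟪u, ξ⟫)) (ν n))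
    (hconv : ∀ u ∈ interior (dualCone K) ∪ {0},
      Tendsto (fun n => ∫ ξ, Real.exp (-⟪u, ξ⟫) ∂(ν n)) atTop (nhds (L u)))
    (hLcont : ContinuousWithinAt L (interior (dualCone K) ∪ {0}) 0)
    (e : V) (he : e ∈ interior (dualCone K)) (ε : ℝ≥0∞) (hε : 0 < ε) :
    ∃ R : ℝ, ∀ᶠ n in atTop, ν n {x | R < ‖⟪e, x⟫‖} ≤ ε := by
  obtain ⟨η, hη0, hηε⟩ := ENNReal.lt_iff_exists_nnreal_btwn.1 hε
  have hη : (0:ℝ) < η := by exact_mod_cast hη0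
  have hG : Tendsto (fun t : ℝ => 2 * (L 0 - L (t • e)) + 3 * t * L e) (𝓝[>] 0) (𝓝 0) := by
    have h1 : Tendsto (fun t : ℝ => t • e) (𝓝[>] 0) (𝓝[interior (dualCone K) ∪ {0}] 0) := by
      rw [tendsto_nhdsWithin_iff]
      constructor
      · have : Continuous (fun t : ℝ => t • e) := by fun_prop
        have h := this.tendsto 0
        rw [zero_smul] at h
        exact h.mono_left nhdsWithin_le_nhds
      · filter_upwards [self_mem_nhdsWithin] with t ht
        exact Or.inl (smul_mem_interior_dual K ht he)
    have h2 : Tendsto (fun t : ℝ => L (t • e)) (𝓝[>] 0) (𝓝 (L 0)) := hLcont.tendsto.comp h1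
    have h3 : Tendsto (fun t : ℝ => t) (𝓝[>] 0) (𝓝 0) := nhdsWithin_le_nhds
    have := ((h2.const_sub (L 0)).const_mul 2).add ((h3.const_mul 3).mul_const (L e))
    simpa using this
  obtain ⟨t, htG, ht0, ht1⟩ : ∃ t : ℝ, 2 * (L 0 - L (t • e)) + 3 * t * L e < η ∧ 0 < t ∧ t < 1 := by
    have a := hG.eventually_lt_const hη
    have b : ∀ᶠ t : ℝ in 𝓝[>] 0, t ∈ Ioo (0:ℝ) 1 := Ioo_mem_nhdsGT one_pos
    obtain ⟨t, h1, h2⟩ := (a.and b).exists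
    exact ⟨t, h1, h2.1, h2.2⟩
  have m0 : (0:V) ∈ interior (dualCone K) ∪ {0} := Or.inr rfl
  have mt : t • e ∈ interior (dualCone K) ∪ {0} := Or.inl (smul_mem_interior_dual K ht0 he)
  have me : e ∈ interior (dualCone K) ∪ {0} := Or.inl he
  refine ⟨1 / t, ?_⟩
  have hlim := (((hconv 0 m0).sub (hconv _ mt)).const_mul 2).add ((hconv e me).const_mul (3 * t))
  filter_upwards [hlim.eventually_lt_const htG] with n hn
  refine le_trans ?_ hηε.le
  set A := {x : V | 1 / t < ‖⟪e, x⟫‖} with hA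
  have hAm : MeasurableSet A := measurableSet_lt measurable_const (by fun_prop)
  have hreal : (ν n).real A ≤ η := by
    rw [← integral_indicator_one hAm]
    refine le_trans ?_ hn.le
    have hi1 : Integrable (fun ξ => 2 * (Real.exp (-⟪(0:V), ξ⟫) - Real.exp (-⟪t • e, ξ⟫))) (ν n) :=
      ((hint n 0 m0).sub (hint n _ mt)).const_mul 2
    have hi2 : Integrable (fun ξ => 3 * t * Real.exp (-⟪e, ξ⟫)) (ν n) :=
      (hint n e me).const_mul _
    rw [← integral_sub (hint n 0 m0) (hint n _ mt), ← integral_const_mul, ← integral_const_mul,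
      ← integral_add hi1 hi2]
    refine integral_mono ((integrable_const (1:ℝ)).indicator hAm) (hi1.add hi2) fun x => ?_
    have := pt_bound t ⟪e, x⟫ ht0 ht1.le
    simp only [inner_zero_left, neg_zero, Real.exp_zero, real_inner_smul_left]
    exact this
  rw [← ENNReal.ofReal_coe_nnreal]
  exact (ENNReal.le_ofReal_iff_toReal_le (measure_ne_top _ _) hη.le).2 hreal

lemma laplace_tight {V : Type*} [NormedAddCommGroup V] [InnerProductSpace ℝ V]
    [FiniteDimensional ℝ V] [MeasurableSpace V] [BorelSpace V]
    (K : Set V) (hne : (interior (dualCone K)).Nonempty)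
    (ν : ℕ → Measure V) (L : V → ℝ) [∀ n, IsFiniteMeasure (ν n)]
    (hint : ∀ n : ℕ, ∀ u ∈ interior (dualCone K) ∪ {0},
      Integrable (fun ξ => Real.exp (-⟪u, ξ⟫)) (ν n))
    (hconv : ∀ u ∈ interior (dualCone K) ∪ {0},
      Tendsto (fun n => ∫ ξ, Real.exp (-⟪u, ξ⟫) ∂(ν n)) atTop (nhds (L u)))
    (hLcont : ContinuousWithinAt L (interior (dualCone K) ∪ {0}) 0) :
    IsTightMeasureSet (Set.range ν) := by
  obtain ⟨e, he⟩ := hne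
  apply isTightMeasureSet_range_of_tendsto_limsup_inner ℝ
  intro y
  rw [ENNReal.tendsto_atTop_zero]
  intro ε hε
  obtain ⟨δ, hδ, hδ0⟩ : ∃ δ : ℝ, e + δ • y ∈ interior (dualCone K) ∧ 0 < δ := by
    have : Continuous (fun t : ℝ => e + t • y) := by fun_prop
    have h := this.continuousAt.eventually_mem (x := 0)
      (isOpen_interior.mem_nhds (by simpa using he))
    have b : ∀ᶠ t : ℝ in 𝓝[>] 0, 0 < t := self_mem_nhdsWithin
    exact ((h.filter_mono nhdsWithin_le_nhds).and b).exists
  obtain ⟨R1, h1⟩ := tail_bound K ν L hint hconv hLcont e he (ε / 2) (ENNReal.half_pos hε.ne')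
  obtain ⟨R2, h2⟩ := tail_bound K ν L hint hconv hLcont _ hδ (ε / 2) (ENNReal.half_pos hε.ne')
  refine ⟨(R1 + R2) / δ, fun r hr => ?_⟩
  refine limsup_le_of_le (by isBoundedDefault) ?_
  filter_upwards [h1, h2] with n h1 h2
  rw [← ENNReal.add_halves ε]
  refine le_trans (measure_mono ?_) ((measure_union_le _ _).trans (add_le_add h1 h2))
  intro x hx
  by_contra hcon
  simp only [Set.mem_union, Set.mem_ofPred_eq, not_or, not_lt, inner_add_left,
    real_inner_smul_left, Real.norm_eq_abs] at hcon hx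
  rw [ge_iff_le, div_le_iff₀ hδ0] at hr
  have e1 : |δ * ⟪y, x⟫| ≤ |⟪e, x⟫ + δ * ⟪y, x⟫| + |⟪e, x⟫| := by
    have := abs_sub (⟪e, x⟫ + δ * ⟪y, x⟫) ⟪e, x⟫
    simpa using this
  rw [abs_mul, abs_of_pos hδ0] at e1
  nlinarith [hcon.1, hcon.2]

lemma tight_compact {V : Type*} [NormedAddCommGroup V] 
    [MeasurableSpace V] [BorelSpace V] (m : ℕ → FiniteMeasure V)
    (ht : IsTightMeasureSet (Set.range fun n => (m n : Measure V)))
    (B : NNReal) (hB : ∀ n, (m n).mass ≤ B) :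
    ∃ S : Set (FiniteMeasure V), IsCompact S ∧ ∀ n, m n ∈ S := by
  obtain ⟨u, -, u_pos, u_lim⟩ :
      ∃ u : ℕ → NNReal, StrictAnti u ∧ (∀ n, 0 < u n) ∧ Tendsto u atTop (𝓝 0) :=
    exists_seq_strictAnti_tendsto 0
  have A n : ∃ (K : Set V), IsCompact K ∧ ∀ k, m k Kᶜ ≤ u n := by
    rcases isTightMeasureSet_iff_exists_isCompact_measure_compl_le.1 ht (u n)
      (by norm_cast; exact u_pos n) with ⟨K, K_comp, hK⟩
    refine ⟨K, K_comp, fun k ↦ ?_⟩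
    have : (m k : Measure V) Kᶜ ≤ u n := hK _ ⟨k, rfl⟩
    exact ENNReal.coe_le_coe.1 (by rwa [FiniteMeasure.ennreal_coeFn_eq_coeFn_toMeasure])
  choose K K_comp hK using A
  exact ⟨_, isCompact_setOfPred_finiteMeasure_mass_le_compl_isCompact_le B u_lim K_comp
    (Or.inl inferInstance), fun k => ⟨hB k, fun n => hK n k⟩⟩

/-- convergence of Laplace transforms.  If `(ν n)` are Borel measures on
`V` whose Laplace transforms `L_n(u) = ∫ e^{-⟪u,ξ⟫} dν_n` are finite on `K̊* ∪ {0}`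
and converge pointwise there to a function `L` continuous at `0`, then the `ν n`
converge weakly to a finite measure `ν`, their Fourier–Laplace transforms converge to
that of `ν` for `u ∈ K̊* ∪ {0}` and `v ∈ V`, the total masses converge, and
`L(u) = ∫ e^{-⟪u,ξ⟫} dν` on `K̊* ∪ {0}`. -/
theorem laplace_convergence
    {V : Type*} [NormedAddCommGroup V] [InnerProductSpace ℝ V] [FiniteDimensional ℝ V]
    [MeasurableSpace V] [BorelSpace V]
    (K : Set V) (hK : IsProperConvexCone K)
    (ν : ℕ → Measure V) (L : V → ℝ)
    (hint : ∀ n : ℕ, ∀ u ∈ interior (dualCone K) ∪ {0},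
      Integrable (fun ξ => Real.exp (-⟪u, ξ⟫)) (ν n))
    (hconv : ∀ u ∈ interior (dualCone K) ∪ {0},
      Tendsto (fun n => ∫ ξ, Real.exp (-⟪u, ξ⟫) ∂(ν n)) atTop (nhds (L u)))
    (hLcont : ContinuousWithinAt L (interior (dualCone K) ∪ {0}) 0) :
    ∃ μ : Measure V, IsFiniteMeasure μ ∧
      (∀ f : BoundedContinuousFunction V ℝ,
        Tendsto (fun n => ∫ ξ, f ξ ∂(ν n)) atTop (nhds (∫ ξ, f ξ ∂μ))) ∧
      (∀ u ∈ interior (dualCone K) ∪ {0}, ∀ v : V,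
        Tendsto
          (fun n => ∫ ξ, Complex.exp (-(⟪u, ξ⟫ : ℂ) - Complex.I * (⟪v, ξ⟫ : ℂ)) ∂(ν n))
          atTop
          (nhds (∫ ξ, Complex.exp (-(⟪u, ξ⟫ : ℂ) - Complex.I * (⟪v, ξ⟫ : ℂ)) ∂μ))) ∧
      Tendsto (fun n => (ν n Set.univ).toReal) atTop (nhds (μ Set.univ).toReal) ∧
      ∀ u ∈ interior (dualCone K) ∪ {0}, L u = ∫ ξ, Real.exp (-⟪u, ξ⟫) ∂μ := by
  have hne := cone_interior_nonempty K hK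
  have m0 : (0:V) ∈ interior (dualCone K) ∪ {0} := Or.inr rfl
  have hfin : ∀ n, IsFiniteMeasure (ν n) := fun n => by
    have := hint n 0 m0
    simpa [integrable_const_iff] using this
  have hdbl : ∀ u ∈ interior (dualCone K) ∪ {0}, (2:ℝ) • u ∈ interior (dualCone K) ∪ {0} := by
    rintro u (hu | hu)
    · exact Or.inl (smul_mem_interior_dual K two_pos hu)
    · rw [Set.mem_singleton_iff] at hu; subst hu; rw [smul_zero]; exact m0
  have hsq : ∀ u ξ : V, Real.exp (-⟪u, ξ⟫) ^ 2 = Real.exp (-⟪(2:ℝ) • u, ξ⟫) := by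
    intro u ξ
    rw [← Real.exp_nat_mul, real_inner_smul_left]; congr 1; push_cast; ring
  -- transfer to weak limits
  have htrans : ∀ (F : Filter ℕ) [F.NeBot] (μ : Measure V) [IsFiniteMeasure μ],
      (∀ f : BoundedContinuousFunction V ℝ,
        Tendsto (fun n => ∫ ξ, f ξ ∂(ν n)) F (nhds (∫ ξ, f ξ ∂μ))) →
      ∀ u ∈ interior (dualCone K) ∪ {0}, ∀ φ : V → ℝ, Continuous φ → (∀ x, |φ x| ≤ 1) →
      Integrable (fun ξ => Real.exp (-⟪u, ξ⟫)) μ ∧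
        Tendsto (fun n => ∫ ξ, Real.exp (-⟪u, ξ⟫) * φ ξ ∂(ν n)) F
          (nhds (∫ ξ, Real.exp (-⟪u, ξ⟫) * φ ξ ∂μ)) := by
    intro F _ μ _ hw u hu φ hφ hφ1
    obtain ⟨B, hB⟩ := (hconv _ (hdbl u hu)).bddAbove_range
    refine weak_unif ν μ hw (fun ξ => Real.exp (-⟪u, ξ⟫)) (by fun_prop)
      (fun x => (Real.exp_pos _).le) B (fun i => hint i u hu) ?_ ?_ φ hφ hφ1
    · intro i; simp only [hsq]; exact hint i _ (hdbl u hu)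
    · intro i; simp only [hsq]; exact hB ⟨i, rfl⟩
  have hlap : ∀ (F : Filter ℕ) [F.NeBot] (μ : Measure V) [IsFiniteMeasure μ], F ≤ atTop →
      (∀ f : BoundedContinuousFunction V ℝ,
        Tendsto (fun n => ∫ ξ, f ξ ∂(ν n)) F (nhds (∫ ξ, f ξ ∂μ))) →
      ∀ u ∈ interior (dualCone K) ∪ {0}, Integrable (fun ξ => Real.exp (-⟪u, ξ⟫)) μ ∧
        L u = ∫ ξ, Real.exp (-⟪u, ξ⟫) ∂μ := by
    intro F _ μ _ hF hw u hu
    obtain ⟨h1, h2⟩ := htrans F μ hw u hu (fun _ => 1) continuous_const (by simp)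
    refine ⟨h1, ?_⟩
    simp only [mul_one] at h2
    exact tendsto_nhds_unique ((hconv u hu).mono_left hF) h2
  let m : ℕ → FiniteMeasure V := fun n => ⟨ν n, hfin n⟩
  have ht := laplace_tight K hne ν L hint hconv hLcont
  obtain ⟨B, hB⟩ := (hconv 0 m0).bddAbove_range
  have hmass : ∀ n, (m n).mass ≤ B.toNNReal := by
    intro n
    have h := hB ⟨n, rfl⟩
    simp only [inner_zero_left, neg_zero, Real.exp_zero, integral_const, smul_eq_mul,
      mul_one] at h
    exact NNReal.le_toNNReal_of_coe_le h
  obtain ⟨S, hS, hmS⟩ := tight_compact m ht _ hmass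
  obtain ⟨μ, hμS, hμ⟩ := hS.exists_mapClusterPt (f := atTop) (u := m)
    (by rw [le_principal_iff]; exact Filter.mem_map.2 (Eventually.of_forall hmS))
  have hclust : ∀ κ : FiniteMeasure V, MapClusterPt κ atTop m →
      ∀ u ∈ interior (dualCone K) ∪ {0}, Integrable (fun ξ => Real.exp (-⟪u, ξ⟫)) (κ : Measure V) ∧
        L u = ∫ ξ, Real.exp (-⟪u, ξ⟫) ∂(κ : Measure V) := by
    intro κ hκ
    obtain ⟨U, hU, hUt⟩ := mapClusterPt_iff_ultrafilter.1 hκ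
    exact hlap U κ hU (FiniteMeasure.tendsto_iff_forall_integral_tendsto.1 hUt)
  have hlim : Tendsto m atTop (𝓝 μ) := by
    refine hS.tendsto_nhds_of_unique_mapClusterPt (Eventually.of_forall hmS) fun κ _ hκ => ?_
    obtain ⟨e, he⟩ := hne
    apply Subtype.ext
    refine laplace_unique (κ : Measure V) (μ : Measure V) _ isOpen_interior e he
      (fun u hu => (hclust κ hκ u (Or.inl hu)).1) (fun u hu => (hclust μ hμ u (Or.inl hu)).1)
      fun u hu => ?_
    rw [← (hclust κ hκ u (Or.inl hu)).2, ← (hclust μ hμ u (Or.inl hu)).2]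
  have hw : ∀ f : BoundedContinuousFunction V ℝ,
        Tendsto (fun n => ∫ ξ, f ξ ∂(ν n)) atTop (nhds (∫ ξ, f ξ ∂(μ : Measure V))) :=
    FiniteMeasure.tendsto_iff_forall_integral_tendsto.1 hlim
  refine ⟨μ, inferInstance, hw, ?_, ?_, fun u hu => (hclust μ hμ u hu).2⟩
  · intro u hu v
    have hc := htrans atTop μ hw u hu (fun ξ => Real.cos ⟪v, ξ⟫) (by fun_prop)
      (fun x => Real.abs_cos_le_one _)
    have hs := htrans atTop μ hw u hu (fun ξ => Real.sin ⟪v, ξ⟫) (by fun_prop)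
      (fun x => Real.abs_sin_le_one _)
    have hform : ∀ κ : Measure V, Integrable (fun ξ => Real.exp (-⟪u, ξ⟫)) κ →
        ∫ ξ, Complex.exp (-(⟪u, ξ⟫ : ℂ) - Complex.I * (⟪v, ξ⟫ : ℂ)) ∂κ
        = ((∫ ξ, Real.exp (-⟪u, ξ⟫) * Real.cos ⟪v, ξ⟫ ∂κ : ℝ) : ℂ)
          - Complex.I * ((∫ ξ, Real.exp (-⟪u, ξ⟫) * Real.sin ⟪v, ξ⟫ ∂κ : ℝ) : ℂ) := by
      intro κ hκ
      have i1 : Integrable (fun ξ => Real.exp (-⟪u, ξ⟫) * Real.cos ⟪v, ξ⟫) κ := by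
        refine Integrable.mono' hκ (by fun_prop) (Eventually.of_forall fun x => ?_)
        rw [norm_mul, Real.norm_of_nonneg (Real.exp_pos _).le, Real.norm_eq_abs]
        exact mul_le_of_le_one_right (Real.exp_pos _).le (Real.abs_cos_le_one _)
      have i2 : Integrable (fun ξ => Real.exp (-⟪u, ξ⟫) * Real.sin ⟪v, ξ⟫) κ := by
        refine Integrable.mono' hκ (by fun_prop) (Eventually.of_forall fun x => ?_)
        rw [norm_mul, Real.norm_of_nonneg (Real.exp_pos _).le, Real.norm_eq_abs]
        exact mul_le_of_le_one_right (Real.exp_pos _).le (Real.abs_sin_le_one _)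
      rw [← integral_complex_ofReal, ← integral_complex_ofReal, ← integral_const_mul,
        ← integral_sub i1.ofReal (i2.ofReal.const_mul _)]
      congr 1
      ext ξ
      rw [sub_eq_add_neg, Complex.exp_add,
        show -(Complex.I * (⟪v, ξ⟫ : ℂ)) = (-(⟪v, ξ⟫ : ℂ)) * Complex.I by ring, Complex.exp_mul_I,
        Complex.cos_neg, Complex.sin_neg]
      push_cast
      ring
    simp only [fun n => hform (ν n) (hint n u hu), hform μ hc.1]
    exact ((Complex.continuous_ofReal.tendsto _).comp hc.2).sub
      (((Complex.continuous_ofReal.tendsto _).comp hs.2).const_mul _)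
  · have := hw (BoundedContinuousFunction.const V 1)
    simpa [measureReal_def] using this
end

section
/- Every element ψ of 𝒞_S maps K* into K*, and the classes 𝒞 and 𝒞_S are closed under composition: if φ ∈ 𝒞 and ψ ∈ 𝒞_S, then the composition u ↦ φ(ψ(u)) belongs to 𝒞; and if ψ, ψ₁ ∈ 𝒞_S, then u ↦ ψ₁(ψ(u)) belongs to 𝒞_S. -/
open MeasureTheory Filter Set
open scoped RealInnerProductSpace ENNReal Topology

/-- `f` belongs to the class `𝒞`: it is the sum of a function of subordinator
Lévy–Khintchine form on `K` and a nonnegative constant. -/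
def MemC {V : Type*} [NormedAddCommGroup V] [InnerProductSpace ℝ V] [MeasurableSpace V]
    (K : Set V) (f : V → ℝ) : Prop :=
  ∃ b ∈ K, ∃ c : ℝ, 0 ≤ c ∧ ∃ m : MeasureTheory.Measure V, m Kᶜ = 0 ∧
    (∫⁻ ξ, ENNReal.ofReal (min ‖ξ‖ 1) ∂m) < ⊤ ∧
    ∀ u ∈ dualCone K, f u = ⟪b, u⟫ + c - ∫ ξ, (Real.exp (-⟪u, ξ⟫) - 1) ∂m

/-- `ψ` belongs to the class `𝒞_S`: `u ↦ ⟪ψ(u), x⟫` belongs to `𝒞` for every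
`x ∈ K`. -/
def MemCS {V : Type*} [NormedAddCommGroup V] [InnerProductSpace ℝ V] [MeasurableSpace V]
    (K : Set V) (ψ : V → V) : Prop :=
  ∀ x ∈ K, MemC K (fun u => ⟪ψ u, x⟫)


section Helpers

variable {V : Type*} [NormedAddCommGroup V] [InnerProductSpace ℝ V]

lemma zero_mem_dual (K : Set V) : (0 : V) ∈ dualCone K := by
  intro x _; simp

lemma smul_mem_dual {K : Set V} {u : V} (hu : u ∈ dualCone K) {t : ℝ} (ht : 0 ≤ t) :
    t • u ∈ dualCone K := by
  intro x hx
  rw [inner_smul_right]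
  exact mul_nonneg ht (hu x hx)

lemma dual_nonneg {K : Set V} {u : V} (hu : u ∈ dualCone K) {x : V} (hx : x ∈ K) :
    0 ≤ ⟪u, x⟫ := by
  rw [real_inner_comm]; exact hu x hx

lemma cone_zero {K : Set V} (hK : IsProperConvexCone K) : (0 : V) ∈ K := by
  have : (0 : V) ∈ K ∩ (-K) := by rw [hK.proper]; rfl
  exact this.1

lemma cone_add {K : Set V} (hK : IsProperConvexCone K) {x y : V} (hx : x ∈ K) (hy : y ∈ K) :
    x + y ∈ K := by
  have h := hK.convex hx hy (a := 1/2) (b := 1/2) (by norm_num) (by norm_num) (by norm_num)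
  have h2 := hK.smul_mem 2 (by norm_num) _ h
  rw [smul_add, smul_smul, smul_smul] at h2
  norm_num at h2
  exact h2

lemma exists_dual_neg [FiniteDimensional ℝ V] {K : Set V} (hK : IsProperConvexCone K) {x : V}
    (hx : x ∉ K) : ∃ u ∈ dualCone K, ⟪x, u⟫ < 0 := by
  have : CompleteSpace V := FiniteDimensional.complete ℝ V
  let C : ProperCone ℝ V :=
    { carrier := K
      add_mem' := fun ha hb => cone_add hK ha hb
      zero_mem' := cone_zero hK
      smul_mem' := fun c x hx => hK.smul_mem c c.2 x hx
      isClosed' := hK.isClosed }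
  obtain ⟨y, h1, h2⟩ := C.hyperplane_separation' (x₀ := x) hx
  exact ⟨y, h1, h2⟩

/-- interior point of the dual cone -/
lemma exists_u0 [FiniteDimensional ℝ V] {K : Set V} (hK : IsProperConvexCone K) :
    ∃ u ∈ dualCone K, ∀ x ∈ K, ‖x‖ ≤ ⟪u, x⟫ := by
  have : ProperSpace V := FiniteDimensional.proper ℝ V
  have hS : IsCompact (K ∩ Metric.sphere (0 : V) 1) :=
    (isCompact_sphere (0 : V) 1).inter_left hK.isClosed
  have hpos : ∀ x ∈ K ∩ Metric.sphere (0 : V) 1, ∃ u ∈ dualCone K, 0 < ⟪u, x⟫ := by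
    rintro x ⟨hxK, hx1⟩
    have hx : -x ∉ K := by
      intro h
      have : x ∈ K ∩ (-K) := ⟨hxK, by simpa using h⟩
      rw [hK.proper] at this
      simp at this
      simp [this] at hx1
    obtain ⟨u, hu, h⟩ := exists_dual_neg hK hx
    refine ⟨u, hu, ?_⟩
    rw [inner_neg_left] at h
    rw [real_inner_comm]; linarith
  have hfin := hS.elim_finite_subcover (fun u : dualCone K => {x : V | 0 < ⟪(u : V), x⟫})
    (fun u => isOpen_lt continuous_const (by fun_prop))
    (by
      intro x hx
      obtain ⟨u, hu, h⟩ := hpos x hx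
      exact mem_iUnion.2 ⟨⟨u, hu⟩, h⟩)
  obtain ⟨t, ht⟩ := hfin
  set w : V := ∑ u ∈ t, (u : V) with hw
  have hwd : w ∈ dualCone K := by
    intro x hx
    rw [hw, inner_sum]
    exact Finset.sum_nonneg fun u _ => u.2 x hx
  have hwpos : ∀ x ∈ K ∩ Metric.sphere (0 : V) 1, 0 < ⟪w, x⟫ := by
    intro x hx
    rw [hw, sum_inner]
    obtain ⟨u, hut, hux⟩ := mem_iUnion₂.1 (ht hx)
    exact Finset.sum_pos' (fun v _ => dual_nonneg v.2 hx.1) ⟨u, hut, hux⟩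
  have hδ : ∃ δ > 0, ∀ x ∈ K ∩ Metric.sphere (0 : V) 1, δ ≤ ⟪w, x⟫ := by
    rcases (K ∩ Metric.sphere (0 : V) 1).eq_empty_or_nonempty with h | h
    · exact ⟨1, one_pos, by simp [h]⟩
    · obtain ⟨x, hx, hm⟩ := hS.exists_isMinOn h (f := fun x => ⟪w, x⟫)
        (Continuous.continuousOn (by fun_prop))
      exact ⟨⟪w, x⟫, hwpos x hx, fun y hy => hm hy⟩
  obtain ⟨δ, hδ0, hδ⟩ := hδ
  refine ⟨δ⁻¹ • w, smul_mem_dual hwd (by positivity), fun x hx => ?_⟩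
  rcases eq_or_ne x 0 with rfl | hx0
  · simp
  have hn : 0 < ‖x‖ := norm_pos_iff.2 hx0
  have h := hδ (‖x‖⁻¹ • x) ⟨hK.smul_mem _ (by positivity) x hx, by
    simp [norm_smul, hn.ne']⟩
  rw [inner_smul_right] at h
  rw [inner_smul_left]
  simp only [conj_trivial]
  rw [inv_mul_eq_div, le_div_iff₀ hδ0]
  rw [inv_mul_eq_div, le_div_iff₀ hn] at h
  linarith

/-- Laplace transforms of finite measures on `K`. -/
def IsLap [MeasurableSpace V] (K : Set V) (g : V → ℝ) : Prop :=
  ∃ μ : Measure V, IsFiniteMeasure μ ∧ μ Kᶜ = 0 ∧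
    ∀ u ∈ dualCone K, g u = ∫ x, Real.exp (-⟪u, x⟫) ∂μ

/-- Continuity at zero along rays. -/
def RadCont (K : Set V) (g : V → ℝ) : Prop :=
  ∀ u ∈ dualCone K, Tendsto (fun k : ℕ => g ((1 / ((k : ℝ) + 1)) • u)) atTop (𝓝 (g 0))

variable [FiniteDimensional ℝ V] [MeasurableSpace V] [BorelSpace V]

lemma ae_mem {K : Set V} {μ : Measure V} (h : μ Kᶜ = 0) : ∀ᵐ x ∂μ, x ∈ K := by
  rw [ae_iff]; exact h

lemma integrable_exp {K : Set V} {μ : Measure V} [IsFiniteMeasure μ] (h : μ Kᶜ = 0) {u : V}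
    (hu : u ∈ dualCone K) : Integrable (fun x => Real.exp (-⟪u, x⟫)) μ := by
  refine Integrable.of_bound (C := 1) (Continuous.aestronglyMeasurable (by fun_prop)) ?_
  filter_upwards [ae_mem h] with x hx
  rw [Real.norm_eq_abs, abs_of_pos (Real.exp_pos _), Real.exp_le_one_iff]
  linarith [dual_nonneg hu hx]

lemma ct {K : Set V} (hK : IsProperConvexCone K) {g : V → ℝ} (G : ℕ → V → ℝ)
    (hG : ∀ n, IsLap K (G n))
    (hlim : ∀ u ∈ dualCone K, Tendsto (fun n => G n u) atTop (𝓝 (g u)))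
    (hcont : RadCont K g) : IsLap K g := by
  have : ProperSpace V := FiniteDimensional.proper ℝ V
  choose μ hfin hsupp hμ using hG
  obtain ⟨u0, hu0, hu0n⟩ := exists_u0 hK
  -- tightness
  have htail : ∀ (n : ℕ) (t : ℝ), 0 < t → ∀ r : ℝ, 1 / t ≤ r →
      (μ n).real {x | r < ‖x‖} ≤ 2 * (G n 0 - G n (t • u0)) := by
    intro n t ht r hr
    have h1 := integrable_exp (hsupp n) (zero_mem_dual K)
    have h2 := integrable_exp (hsupp n) (smul_mem_dual hu0 ht.le)
    rw [hμ n 0 (zero_mem_dual K), hμ n _ (smul_mem_dual hu0 ht.le), ← integral_sub h1 h2,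
      ← integral_const_mul]
    have hms : MeasurableSet {x : V | r < ‖x‖} := measurableSet_lt measurable_const measurable_norm
    rw [← integral_indicator_one hms]
    refine integral_mono_ae ((integrable_const (1 : ℝ)).indicator hms) ((h1.sub h2).const_mul 2) ?_
    filter_upwards [ae_mem (hsupp n)] with x hx
    have hi : ‖x‖ * t ≤ ⟪t • u0, x⟫ := by
      rw [inner_smul_left]; simp only [conj_trivial]
      nlinarith [hu0n x hx]
    have hn := norm_nonneg x
    have hnn : 0 ≤ ⟪t • u0, x⟫ := le_trans (by positivity) hi
    simp only [inner_zero_left, neg_zero, Real.exp_zero, Set.indicator_apply, mem_ofPred_eq]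
    split_ifs with hx'
    · have : 1 ≤ ⟪t • u0, x⟫ := by
        rw [div_le_iff₀ ht] at hr
        nlinarith
      have h3 : Real.exp (-⟪t • u0, x⟫) ≤ 1 / 2 := by
        rw [Real.exp_neg, inv_eq_one_div]
        apply one_div_le_one_div_of_le (by norm_num)
        linarith [Real.add_one_le_exp ⟪t • u0, x⟫]
      simp only [Pi.one_apply]
      linarith
    · have : Real.exp (-⟪t • u0, x⟫) ≤ 1 := by
        rw [Real.exp_le_one_iff]; linarith
      linarith
  have htight : IsTightMeasureSet (Set.range μ) := by
    apply isTightMeasureSet_range_of_tendsto_limsup_measure_norm_gt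
    rw [ENNReal.tendsto_nhds_zero]
    intro ε hε
    obtain ⟨e, he0, hee⟩ : ∃ e : ℝ, 0 < e ∧ ENNReal.ofReal e ≤ ε := by
      rcases eq_or_ne ε ⊤ with rfl | h
      · exact ⟨1, one_pos, le_top⟩
      · exact ⟨ε.toReal, ENNReal.toReal_pos hε.ne' h, ENNReal.ofReal_toReal_le⟩
    have hk : ∀ᶠ k : ℕ in atTop, g 0 - g ((1 / ((k : ℝ) + 1)) • u0) < e / 4 := by
      have h := (hcont u0 hu0).const_sub (g 0)
      rw [sub_self] at h
      exact h.eventually_lt_const (by linarith)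
    obtain ⟨k, hk⟩ := hk.exists
    set t : ℝ := 1 / ((k : ℝ) + 1) with htdef
    have ht : 0 < t := by positivity
    have hn : ∀ᶠ n in atTop, G n 0 - G n (t • u0) < e / 2 :=
      ((hlim 0 (zero_mem_dual K)).sub (hlim _ (smul_mem_dual hu0 ht.le))).eventually_lt_const
        (by linarith)
    filter_upwards [eventually_ge_atTop (1 / t)] with r hr
    refine limsup_le_of_le (by isBoundedDefault) ?_
    filter_upwards [hn] with n hn
    refine le_trans ?_ hee
    rw [← ENNReal.ofReal_toReal (measure_ne_top (μ n) _)]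
    apply ENNReal.ofReal_le_ofReal
    have := htail n t ht r hr
    rw [Measure.real] at this
    linarith
  -- extraction
  let M : ℕ → FiniteMeasure V := fun n => ⟨μ n, hfin n⟩
  obtain ⟨w, -, w_pos, w_lim⟩ :
      ∃ w : ℕ → NNReal, StrictAnti w ∧ (∀ n, 0 < w n) ∧ Tendsto w atTop (𝓝 0) :=
    exists_seq_strictAnti_tendsto 0
  have A : ∀ n, ∃ S : Set V, IsCompact S ∧ ∀ k, M k Sᶜ ≤ w n := by
    intro n
    obtain ⟨S, hS, hS'⟩ := isTightMeasureSet_iff_exists_isCompact_measure_compl_le.1 htight (w n)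
      (by exact_mod_cast w_pos n)
    refine ⟨S, hS, fun k => ?_⟩
    have : (M k : Measure V) Sᶜ ≤ w n := hS' _ ⟨k, rfl⟩
    exact ENNReal.coe_le_coe.1 (by rwa [FiniteMeasure.ennreal_coeFn_eq_coeFn_toMeasure])
  choose S hS hS' using A
  have hmass : ∃ C : NNReal, ∀ n, (M n).mass ≤ C := by
    have hb := (hlim 0 (zero_mem_dual K)).bddAbove_range
    obtain ⟨B, hB⟩ := hb
    refine ⟨B.toNNReal, fun n => ?_⟩
    have h := hB ⟨n, rfl⟩
    simp only [hμ n 0 (zero_mem_dual K)] at h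
    simp at h
    rw [← NNReal.coe_le_coe]
    refine le_trans ?_ (Real.le_coe_toNNReal B)
    exact h
  obtain ⟨C, hC⟩ := hmass
  have hcomp := isCompact_setOfPred_finiteMeasure_mass_le_compl_isCompact_le C w_lim hS
    (Or.inl inferInstance)
  obtain ⟨ν, -, hν⟩ := hcomp.ultrafilter_le_nhds ((hyperfilter ℕ).map M) (by
    rw [le_principal_iff]
    change ∀ᶠ n in (hyperfilter ℕ : Filter ℕ), M n ∈ _
    exact Eventually.of_forall fun n => ⟨hC n, fun k => hS' k n⟩)
  have hT : Tendsto M (hyperfilter ℕ) (𝓝 ν) := hν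
  have hle : ((hyperfilter ℕ : Ultrafilter ℕ) : Filter ℕ) ≤ atTop := by
    rw [← Nat.cofinite_eq_atTop]; exact hyperfilter_le_cofinite
  rw [FiniteMeasure.tendsto_iff_forall_integral_tendsto] at hT
  have hsν : (ν : Measure V) Kᶜ = 0 := by
    let f : BoundedContinuousFunction V ℝ := BoundedContinuousFunction.ofNormedAddCommGroup
      (fun x => min (Metric.infDist x K) 1) (by fun_prop) 1 (by
        intro x
        rw [Real.norm_eq_abs, abs_of_nonneg (le_min Metric.infDist_nonneg zero_le_one)]
        exact min_le_right _ _)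
    have h := hT f
    have h0 : ∀ n, ∫ x, f x ∂(M n : Measure V) = 0 := by
      intro n
      apply integral_eq_zero_of_ae
      filter_upwards [ae_mem (hsupp n)] with x hx
      change min (Metric.infDist x K) 1 = 0
      rw [Metric.infDist_zero_of_mem hx]; simp
    simp only [h0] at h
    have h1 := tendsto_nhds_unique h tendsto_const_nhds
    have hf0 : 0 ≤ (f : V → ℝ) := fun x => le_min Metric.infDist_nonneg zero_le_one
    rw [integral_eq_zero_iff_of_nonneg hf0 (f.integrable _)] at h1
    have h2 : ∀ᵐ x ∂(ν : Measure V), x ∈ K := by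
      filter_upwards [h1] with x hx
      change min (Metric.infDist x K) 1 = 0 at hx
      rw [hK.isClosed.mem_iff_infDist_zero ⟨0, cone_zero hK⟩]
      rcases min_choice (Metric.infDist x K) 1 with h | h <;> rw [h] at hx
      · exact hx
      · norm_num at hx
    rw [ae_iff] at h2; exact h2
  refine ⟨ν, inferInstance, hsν, fun u hu => ?_⟩
  let f : BoundedContinuousFunction V ℝ := BoundedContinuousFunction.ofNormedAddCommGroup
      (fun x => Real.exp (-(max ⟪u, x⟫ 0))) (by fun_prop) 1 (by
        intro x
        rw [Real.norm_eq_abs, abs_of_pos (Real.exp_pos _), Real.exp_le_one_iff]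
        simp)
  have hf : ∀ m : Measure V, m Kᶜ = 0 → ∫ x, f x ∂m = ∫ x, Real.exp (-⟪u, x⟫) ∂m := by
    intro m hm
    apply integral_congr_ae
    filter_upwards [ae_mem hm] with x hx
    change Real.exp (-(max ⟪u, x⟫ 0)) = _
    rw [max_eq_left (dual_nonneg hu hx)]
  have h := hT f
  rw [hf _ hsν] at h
  have h' : Tendsto (fun n => G n u) (hyperfilter ℕ)
      (𝓝 (∫ x, Real.exp (-⟪u, x⟫) ∂(ν : Measure V))) := by
    refine h.congr fun n => ?_
    rw [hμ n u hu]
    exact hf _ (hsupp n)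
  exact tendsto_nhds_unique ((hlim u hu).mono_left hle) h'

lemma IsLap.congr {K : Set V} {f g : V → ℝ} (hf : IsLap K f)
    (h : ∀ u ∈ dualCone K, g u = f u) : IsLap K g := by
  obtain ⟨μ, h1, h2, h3⟩ := hf
  exact ⟨μ, h1, h2, fun u hu => (h u hu).trans (h3 u hu)⟩

lemma IsLap.add {K : Set V} {f g : V → ℝ} (hf : IsLap K f) (hg : IsLap K g) :
    IsLap K (fun u => f u + g u) := by
  obtain ⟨μ, h1, h2, h3⟩ := hf
  obtain ⟨ν, k1, k2, k3⟩ := hg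
  refine ⟨μ + ν, inferInstance, by simp [h2, k2], fun u hu => ?_⟩
  beta_reduce
  rw [integral_add_measure (integrable_exp h2 hu) (integrable_exp k2 hu), h3 u hu, k3 u hu]

lemma IsLap.mul {K : Set V} (hK : IsProperConvexCone K) {f g : V → ℝ} (hf : IsLap K f)
    (hg : IsLap K g) : IsLap K (fun u => f u * g u) := by
  obtain ⟨μ, h1, h2, h3⟩ := hf
  obtain ⟨ν, k1, k2, k3⟩ := hg
  have hs : (μ ∗ ν) Kᶜ = 0 := by
    rw [Measure.conv, Measure.map_apply (by fun_prop) hK.isClosed.measurableSet.compl]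
    have e1 : ∀ᵐ p ∂(μ.prod ν), p.1 ∈ K :=
      Measure.quasiMeasurePreserving_fst.ae (ae_mem h2)
    have e2 : ∀ᵐ p ∂(μ.prod ν), p.2 ∈ K :=
      Measure.quasiMeasurePreserving_snd.ae (ae_mem k2)
    have e3 : ∀ᵐ p ∂(μ.prod ν), p.1 + p.2 ∈ K := by
      filter_upwards [e1, e2] with p a b using cone_add hK a b
    rw [ae_iff] at e3; exact e3
  refine ⟨μ ∗ ν, inferInstance, hs, fun u hu => ?_⟩
  beta_reduce
  rw [integral_conv (integrable_exp hs hu), h3 u hu, k3 u hu]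
  simp only [inner_add_right, neg_add, Real.exp_add]
  simp only [integral_const_mul, integral_mul_const]

lemma isLap_const {K : Set V} (hK : IsProperConvexCone K) {c : ℝ} (hc : 0 ≤ c) :
    IsLap K (fun _ => c) := by
  refine ⟨ENNReal.ofReal c • Measure.dirac 0, ?_, ?_, fun u hu => ?_⟩
  · exact Measure.smul_finite _ ENNReal.ofReal_ne_top
  · simp [cone_zero hK, Measure.dirac_apply' _ hK.isClosed.measurableSet.compl]
  · rw [integral_smul_measure]; simp [hc]

lemma isLap_dirac {K : Set V} (hK : IsProperConvexCone K) {b : V} (hb : b ∈ K) :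
    IsLap K (fun u => Real.exp (-⟪b, u⟫)) := by
  refine ⟨Measure.dirac b, inferInstance, ?_, fun u hu => ?_⟩
  · simp [hb, Measure.dirac_apply' _ hK.isClosed.measurableSet.compl]
  · simp [real_inner_comm]

lemma IsLap.pow {K : Set V} (hK : IsProperConvexCone K) {f : V → ℝ} (hf : IsLap K f) (n : ℕ) :
    IsLap K (fun u => f u ^ n) := by
  induction n with
  | zero => simpa using isLap_const hK zero_le_one
  | succ n ih => simpa only [pow_succ] using ih.mul hK hf

lemma isLap_sum {ι : Type*} {K : Set V} (hK : IsProperConvexCone K) (s : Finset ι)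
    (f : ι → V → ℝ) (hf : ∀ i ∈ s, IsLap K (f i)) :
    IsLap K (fun u => ∑ i ∈ s, f i u) := by
  classical
  induction s using Finset.induction_on with
  | empty => simpa using isLap_const hK le_rfl
  | insert a s ha ih =>
    simp only [Finset.sum_insert ha]
    exact (hf a (Finset.mem_insert_self a s)).add
      (ih fun i hi => hf i (Finset.mem_insert_of_mem hi))

lemma ray_mem (k : ℕ) : (0 : ℝ) ≤ 1 / ((k : ℝ) + 1) ∧ 1 / ((k : ℝ) + 1) ≤ 1 := by
  refine ⟨by positivity, ?_⟩
  rw [div_le_one (by positivity)]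
  linarith [(Nat.cast_nonneg k : (0:ℝ) ≤ k)]

lemma ray_tendsto (u : V) :
    Tendsto (fun k : ℕ => (1 / ((k : ℝ) + 1)) • u) atTop (𝓝 0) := by
  simpa using (tendsto_one_div_add_atTop_nhds_zero_nat (𝕜 := ℝ)).smul_const u

lemma ray_exp_tendsto (u x : V) :
    Tendsto (fun k : ℕ => Real.exp (-⟪(1 / ((k : ℝ) + 1)) • u, x⟫)) atTop
      (𝓝 (Real.exp (-⟪(0 : V), x⟫))) := by
  have hc : Continuous (fun v : V => Real.exp (-⟪v, x⟫)) := by fun_prop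
  exact (hc.tendsto 0).comp (ray_tendsto u)

lemma IsLap.radCont {K : Set V} {f : V → ℝ} (hf : IsLap K f) : RadCont K f := by
  obtain ⟨μ, h1, h2, h3⟩ := hf
  intro u hu
  rw [h3 0 (zero_mem_dual K)]
  have : (fun k : ℕ => f ((1 / ((k : ℝ) + 1)) • u)) =
      fun k : ℕ => ∫ x, Real.exp (-⟪(1 / ((k : ℝ) + 1)) • u, x⟫) ∂μ := by
    funext k
    exact h3 _ (smul_mem_dual hu (ray_mem k).1)
  rw [this]
  refine tendsto_integral_of_dominated_convergence (fun _ => (1 : ℝ)) ?_ (integrable_const _) ?_ ?_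
  · exact fun k => Continuous.aestronglyMeasurable (by fun_prop)
  · intro k
    filter_upwards [ae_mem h2] with x hx
    rw [Real.norm_eq_abs, abs_of_pos (Real.exp_pos _), Real.exp_le_one_iff]
    linarith [dual_nonneg (smul_mem_dual hu (ray_mem k).1) hx]
  · exact Eventually.of_forall fun x => ray_exp_tendsto u x

lemma IsLap.exp {K : Set V} (hK : IsProperConvexCone K) {f : V → ℝ} (hf : IsLap K f) :
    IsLap K (fun u => Real.exp (f u)) := by
  refine ct hK (fun n u => ∑ i ∈ Finset.range n, (1 / (i.factorial : ℝ)) * f u ^ i) ?_ ?_ ?_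
  · intro n
    exact isLap_sum hK _ _ fun i _ => (isLap_const hK (by positivity)).mul hK (hf.pow hK i)
  · intro u _
    have h := (NormedSpace.expSeries_div_hasSum_exp (f u)).tendsto_sum_nat
    rw [← Real.exp_eq_exp_ℝ] at h
    refine h.congr fun n => Finset.sum_congr rfl fun i _ => by ring
  · intro u hu
    exact (Real.continuous_exp.tendsto _).comp (hf.radCont u hu)

/-- Levy measures -/
structure LM (K : Set V) (m : Measure V) : Prop where
  supp : m Kᶜ = 0
  fin : (∫⁻ ξ, ENNReal.ofReal (min ‖ξ‖ 1) ∂m) < ⊤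

lemma LM.int_min {K : Set V} {m : Measure V} (h : LM K m) :
    Integrable (fun ξ : V => min ‖ξ‖ 1) m := by
  refine ⟨Continuous.aestronglyMeasurable (by fun_prop), ?_⟩
  rw [hasFiniteIntegral_iff_ofReal
    (Eventually.of_forall fun x => le_min (norm_nonneg x) zero_le_one)]
  exact h.fin

lemma exp_bound {K : Set V} {u x : V} (hu : u ∈ dualCone K) (hx : x ∈ K) {s : ℝ} (hs : 0 ≤ s)
    (hs1 : s ≤ 1) : ‖Real.exp (-⟪s • u, x⟫) - 1‖ ≤ (‖u‖ + 1) * min ‖x‖ 1 := by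
  have h0 := dual_nonneg (smul_mem_dual hu hs) hx
  have h1 : Real.exp (-⟪s • u, x⟫) ≤ 1 := by rw [Real.exp_le_one_iff]; linarith
  have h2 := Real.add_one_le_exp (-⟪s • u, x⟫)
  have h3 := Real.exp_pos (-⟪s • u, x⟫)
  have h4 : ⟪s • u, x⟫ ≤ ‖u‖ * ‖x‖ := by
    rw [inner_smul_left]
    simp only [conj_trivial]
    have := real_inner_le_norm u x
    have := dual_nonneg hu hx
    nlinarith
  have hu' := norm_nonneg u
  have hx' := norm_nonneg x
  rw [Real.norm_eq_abs, abs_sub_comm, abs_of_nonneg (by linarith)]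
  rcases le_total ‖x‖ 1 with h | h
  · rw [min_eq_left h]; nlinarith
  · rw [min_eq_right h]; nlinarith

lemma LM.integrable {K : Set V} {m : Measure V} (h : LM K m) {u : V} (hu : u ∈ dualCone K) :
    Integrable (fun ξ => Real.exp (-⟪u, ξ⟫) - 1) m := by
  refine (h.int_min.const_mul (‖u‖ + 1)).mono' (Continuous.aestronglyMeasurable (by fun_prop)) ?_
  filter_upwards [ae_mem h.supp] with x hx
  simpa using exp_bound hu hx zero_le_one le_rfl

lemma LM.radCont {K : Set V} {m : Measure V} (h : LM K m) :
    RadCont K (fun u => ∫ ξ, (Real.exp (-⟪u, ξ⟫) - 1) ∂m) := by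
  intro u hu
  refine tendsto_integral_of_dominated_convergence (fun ξ => (‖u‖ + 1) * min ‖ξ‖ 1) ?_
    (h.int_min.const_mul _) ?_ ?_
  · exact fun k => Continuous.aestronglyMeasurable (by fun_prop)
  · intro k
    filter_upwards [ae_mem h.supp] with x hx
    exact exp_bound hu hx (ray_mem k).1 (ray_mem k).2
  · exact Eventually.of_forall fun x => (ray_exp_tendsto u x).sub_const 1

lemma LM.nonpos {K : Set V} {m : Measure V} (h : LM K m) {u : V} (hu : u ∈ dualCone K) :
    ∫ ξ, (Real.exp (-⟪u, ξ⟫) - 1) ∂m ≤ 0 := by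
  apply integral_nonpos_of_ae
  filter_upwards [ae_mem h.supp] with x hx
  have : Real.exp (-⟪u, x⟫) ≤ 1 := by
    rw [Real.exp_le_one_iff]; linarith [dual_nonneg hu hx]
  simpa using this

lemma MemC.radCont {K : Set V} {f : V → ℝ} (hf : MemC K f) : RadCont K f := by
  obtain ⟨b, hb, c, hc, m, h1, h2, h3⟩ := hf
  intro u hu
  rw [h3 0 (zero_mem_dual K)]
  have : (fun k : ℕ => f ((1 / ((k : ℝ) + 1)) • u)) = fun k : ℕ =>
      ⟪b, (1 / ((k : ℝ) + 1)) • u⟫ + c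
        - ∫ x, (Real.exp (-⟪(1 / ((k : ℝ) + 1)) • u, x⟫) - 1) ∂m := by
    funext k
    exact h3 _ (smul_mem_dual hu (ray_mem k).1)
  rw [this]
  have hcb : Continuous (fun v : V => ⟪b, v⟫) := by fun_prop
  exact (((hcb.tendsto 0).comp (ray_tendsto u)).add_const c).sub
    ((LM.mk h1 h2).radCont u hu)

lemma MemC.zero_nonneg {K : Set V} {f : V → ℝ} (hf : MemC K f) : 0 ≤ f 0 := by
  obtain ⟨b, hb, c, hc, m, h1, h2, h3⟩ := hf
  rw [h3 0 (zero_mem_dual K)]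
  simpa using hc

lemma MemC.zero_le {K : Set V} {f : V → ℝ} (hf : MemC K f) {u : V} (hu : u ∈ dualCone K) :
    f 0 ≤ f u := by
  obtain ⟨b, hb, c, hc, m, h1, h2, h3⟩ := hf
  rw [h3 0 (zero_mem_dual K), h3 u hu]
  have := (LM.mk h1 h2).nonpos hu
  have := hu b hb
  simp
  linarith

/-- outer regions -/
def outer (V : Type*) [NormedAddCommGroup V] (n : ℕ) : Set V := {ξ | 1 / ((n : ℝ) + 1) ≤ ‖ξ‖}

lemma outer_meas (n : ℕ) : MeasurableSet (outer V n) :=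
  measurableSet_le measurable_const measurable_norm

lemma outer_mono : Monotone (outer V) := by
  intro a b hab x hx
  have hx' : 1 / ((a : ℝ) + 1) ≤ ‖x‖ := hx
  exact (Nat.one_div_le_one_div hab).trans hx'

lemma outer_union : (⋃ n, outer V n) = {0}ᶜ := by
  ext x
  simp only [mem_iUnion, mem_compl_iff, mem_singleton_iff, outer, mem_ofPred_eq]
  constructor
  · rintro ⟨n, hn⟩ rfl
    rw [norm_zero] at hn
    have : (0:ℝ) < 1 / ((n : ℝ) + 1) := by positivity
    linarith
  · intro hx
    obtain ⟨n, hn⟩ := exists_nat_one_div_lt (norm_pos_iff.2 hx)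
    exact ⟨n, hn.le⟩

lemma LM.outer_lt {K : Set V} {m : Measure V} (h : LM K m) (n : ℕ) : m (outer V n) < ⊤ := by
  refine lt_of_le_of_lt (measure_mono ?_)
    (h.int_min.measure_ge_lt_top (ε := 1 / ((n : ℝ) + 1)) (by positivity))
  intro x hx
  exact le_min hx (ray_mem n).2

lemma restrict_supp {K : Set V} {m : Measure V} (h : m Kᶜ = 0) (A : Set V) :
    (m.restrict A) Kᶜ = 0 :=
  le_antisymm ((Measure.restrict_apply_le _ _).trans h.le) (by simp)

lemma MemC.isLap {K : Set V} (hK : IsProperConvexCone K) {f : V → ℝ} (hf : MemC K f) :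
    IsLap K (fun u => Real.exp (-f u)) := by
  have hf' := hf
  obtain ⟨b, hb, c, hc, m, h1, h2, h3⟩ := hf
  have hm : LM K m := ⟨h1, h2⟩
  refine ct hK (fun n u => Real.exp (-⟪b, u⟫) * (Real.exp (-c - m.real (outer V n)) *
    Real.exp (∫ x in outer V n, Real.exp (-⟪u, x⟫) ∂m))) ?_ ?_ ?_
  · intro n
    have : IsFiniteMeasure (m.restrict (outer V n)) := ⟨by simpa using hm.outer_lt n⟩
    refine (isLap_dirac hK hb).mul hK ((isLap_const hK (Real.exp_pos _).le).mul hK ?_)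
    exact IsLap.exp hK ⟨m.restrict (outer V n), this, restrict_supp h1 _, fun u _ => rfl⟩
  · intro u hu
    have ht := tendsto_setIntegral_of_monotone (μ := m) (f := fun x => Real.exp (-⟪u, x⟫) - 1)
      outer_meas outer_mono (hm.integrable hu).integrableOn
    rw [outer_union, setIntegral_eq_integral_of_forall_compl_eq_zero (by
      intro x hx
      simp at hx
      simp [hx])] at ht
    have ht2 := (Real.continuous_exp.tendsto _).comp (ht.const_sub (⟪b, u⟫ + c)).neg
    rw [← h3 u hu] at ht2
    refine ht2.congr fun n => ?_
    have : IsFiniteMeasure (m.restrict (outer V n)) := ⟨by simpa using hm.outer_lt n⟩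
    simp only [Function.comp]
    rw [integral_sub (integrable_exp (restrict_supp h1 _) hu) (integrable_const _),
      ← Real.exp_add, ← Real.exp_add]
    congr 1
    simp
    ring
  · intro u hu
    exact (Real.continuous_exp.tendsto _).comp (hf'.radCont u hu).neg

lemma MemCS.maps {K : Set V} {ψ : V → V} (h : MemCS K ψ) {u : V} (hu : u ∈ dualCone K) :
    ψ u ∈ dualCone K := by
  intro x hx
  rw [real_inner_comm]
  exact (h x hx).zero_nonneg.trans ((h x hx).zero_le hu)

lemma mix {K : Set V} (hK : IsProperConvexCone K) {ψ : V → V} (h : MemCS K ψ) {m : Measure V}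
    [IsFiniteMeasure m] (hm : m Kᶜ = 0) :
    IsLap K (fun u => ∫ ξ, Real.exp (-⟪ψ u, ξ⟫) ∂m) := by
  have hbd : ∀ u ∈ dualCone K, ∀ x ∈ K, ‖Real.exp (-⟪ψ u, x⟫)‖ ≤ 1 := by
    intro u hu x hx
    rw [Real.norm_eq_abs, abs_of_pos (Real.exp_pos _), Real.exp_le_one_iff]
    linarith [dual_nonneg (h.maps hu) hx]
  let s : ℕ → SimpleFunc V V := fun n =>
    SimpleFunc.approxOn id measurable_id K 0 (cone_zero hK) n
  have hsK : ∀ n x, s n x ∈ K := fun n x =>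
    SimpleFunc.approxOn_mem measurable_id (cone_zero hK) n x
  refine ct hK (fun n u => ∫ ξ, Real.exp (-⟪ψ u, s n ξ⟫) ∂m) ?_ ?_ ?_
  · intro n
    have hy : ∀ y ∈ (s n).range, y ∈ K := by
      intro y hy
      obtain ⟨x, rfl⟩ := SimpleFunc.mem_range.1 hy
      exact hsK n x
    refine (isLap_sum hK (s n).range
      (fun y u => m.real (s n ⁻¹' {y}) * Real.exp (-⟪ψ u, y⟫)) ?_).congr ?_
    · intro y hyr
      exact (isLap_const hK measureReal_nonneg).mul hK ((h y (hy y hyr)).isLap hK)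
    · intro u hu
      have hI : Integrable (fun ξ => Real.exp (-⟪ψ u, s n ξ⟫)) m := by
        refine Integrable.of_bound (C := 1) ?_ (Eventually.of_forall fun x => hbd u hu _ (hsK n x))
        exact ((s n).map (fun y => Real.exp (-⟪ψ u, y⟫))).aestronglyMeasurable
      have hun : (⋃ y ∈ (s n).range, s n ⁻¹' {y}) = univ := by
        ext x
        simp
      rw [← setIntegral_univ, ← hun, integral_biUnion_finset]
      · refine Finset.sum_congr rfl fun y _ => ?_
        rw [setIntegral_congr_fun (g := fun _ => Real.exp (-⟪ψ u, y⟫))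
          ((s n).measurableSet_preimage _) (by
            intro x hx
            have : s n x = y := hx
            simp only [this])]
        simp
      · exact fun y _ => (s n).measurableSet_preimage _
      · intro a _ b _ hab
        exact Disjoint.preimage _ (by simpa using hab)
      · exact fun y _ => hI.integrableOn
  · intro u hu
    refine tendsto_integral_of_dominated_convergence (fun _ => (1 : ℝ)) ?_ (integrable_const _)
      ?_ ?_
    · exact fun n => ((s n).map (fun y => Real.exp (-⟪ψ u, y⟫))).aestronglyMeasurable
    · exact fun n => Eventually.of_forall fun x => hbd u hu _ (hsK n x)
    · filter_upwards [ae_mem hm] with x hx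
      have hc : Continuous (fun v : V => Real.exp (-⟪ψ u, v⟫)) := by fun_prop
      exact (hc.tendsto x).comp (SimpleFunc.tendsto_approxOn measurable_id (cone_zero hK)
        (subset_closure hx))
  · intro u hu
    refine tendsto_integral_of_dominated_convergence (fun _ => (1 : ℝ)) ?_ (integrable_const _)
      ?_ ?_
    · exact fun n => Continuous.aestronglyMeasurable (by fun_prop)
    · intro k
      filter_upwards [ae_mem hm] with x hx
      exact hbd _ (smul_mem_dual hu (ray_mem k).1) x hx
    · filter_upwards [ae_mem hm] with x hx
      exact (Real.continuous_exp.tendsto _).comp ((h x hx).radCont u hu).neg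

lemma comp_levy {K : Set V} (hK : IsProperConvexCone K) {ψ : V → V} (h : MemCS K ψ)
    {m : Measure V} (hm : LM K m) :
    ∃ M : Measure V, LM K M ∧ ∀ u ∈ dualCone K,
      ∫ ξ, (Real.exp (-⟪u, ξ⟫) - 1) ∂M =
        ∫ ξ, (Real.exp (-⟪ψ u, ξ⟫) - 1) ∂m - ∫ ξ, (Real.exp (-⟪ψ 0, ξ⟫) - 1) ∂m := by
  let D : ℕ → Set V := disjointed (outer V)
  have hDm : ∀ n, MeasurableSet (D n) := MeasurableSet.disjointed outer_meas
  have hDd : Pairwise (Function.onFun Disjoint D) := disjoint_disjointed _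
  have hDu : (⋃ n, D n) = {0}ᶜ := by
    rw [← outer_union (V := V)]; exact iUnion_disjointed
  have hfin : ∀ n, IsFiniteMeasure (m.restrict (D n)) := fun n => ⟨by
    rw [Measure.restrict_apply_univ]
    exact (measure_mono (disjointed_subset _ n)).trans_lt (hm.outer_lt n)⟩
  have hL := fun n => mix hK h (m := m.restrict (D n)) (restrict_supp hm.supp _)
  choose M hMf hMs hM using hL
  have h0 := zero_mem_dual K
  have key : ∀ u ∈ dualCone K,
      ∫⁻ ξ, ENNReal.ofReal (1 - Real.exp (-⟪u, ξ⟫)) ∂(Measure.sum M) =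
      ∫⁻ ξ, ENNReal.ofReal (Real.exp (-⟪ψ 0, ξ⟫) - Real.exp (-⟪ψ u, ξ⟫)) ∂m := by
    intro u hu
    rw [lintegral_sum_measure]
    have hR : ∫⁻ ξ, ENNReal.ofReal (Real.exp (-⟪ψ 0, ξ⟫) - Real.exp (-⟪ψ u, ξ⟫)) ∂m =
        ∫⁻ ξ in ⋃ n, D n, ENNReal.ofReal (Real.exp (-⟪ψ 0, ξ⟫) - Real.exp (-⟪ψ u, ξ⟫)) ∂m := by
      rw [hDu, setLIntegral_eq_of_support_subset]
      intro x hx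
      contrapose! hx
      simp at hx
      simp [hx]
    rw [hR, lintegral_iUnion hDm hDd]
    congr 1
    funext n
    have hf := hfin n
    have hf' := hMf n
    have hs := restrict_supp hm.supp (D n)
    have i1 := integrable_exp hs (h.maps h0)
    have i2 := integrable_exp hs (h.maps hu)
    have j1 := integrable_exp (hMs n) h0
    have j2 := integrable_exp (hMs n) hu
    have i3 : Integrable (fun x => Real.exp (-⟪ψ 0, x⟫) - Real.exp (-⟪ψ u, x⟫))
        (m.restrict (D n)) := i1.sub i2
    have j3 : Integrable (fun x => 1 - Real.exp (-⟪u, x⟫)) (M n) :=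
      (integrable_const (1 : ℝ)).sub j2
    rw [← ofReal_integral_eq_lintegral_ofReal i3,
      ← ofReal_integral_eq_lintegral_ofReal j3]
    · congr 1
      have e1 := hM n u hu
      have e2 := hM n 0 h0
      have e3 := integral_sub i1 i2
      have e4 := integral_sub j1 j2
      simp only [inner_zero_left, neg_zero, Real.exp_zero] at e2 e4
      linarith
    · filter_upwards [ae_mem (hMs n)] with x hx
      have : Real.exp (-⟪u, x⟫) ≤ 1 := by
        rw [Real.exp_le_one_iff]; linarith [dual_nonneg hu hx]
      simpa using this
    · filter_upwards [ae_mem hs] with x hx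
      have := (h x hx).zero_le hu
      simpa using this
  have hsupp : (Measure.sum M) Kᶜ = 0 := by
    rw [Measure.sum_apply _ hK.isClosed.measurableSet.compl]
    simp [hMs]
  have hint : ∀ u ∈ dualCone K, Integrable
      (fun ξ => Real.exp (-⟪ψ 0, ξ⟫) - Real.exp (-⟪ψ u, ξ⟫)) m := by
    intro u hu
    have := (hm.integrable (h.maps h0)).sub (hm.integrable (h.maps hu))
    refine this.congr (Eventually.of_forall fun x => ?_)
    simp
  have hnn : ∀ u ∈ dualCone K, 0 ≤ᵐ[m]
      (fun ξ => Real.exp (-⟪ψ 0, ξ⟫) - Real.exp (-⟪ψ u, ξ⟫)) := by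
    intro u hu
    filter_upwards [ae_mem hm.supp] with x hx
    have := (h x hx).zero_le hu
    simpa using this
  have hLM : LM K (Measure.sum M) := by
    refine ⟨hsupp, ?_⟩
    obtain ⟨u0, hu0, hu0n⟩ := exists_u0 hK
    calc ∫⁻ ξ, ENNReal.ofReal (min ‖ξ‖ 1) ∂(Measure.sum M)
        ≤ ∫⁻ ξ, 2 * ENNReal.ofReal (1 - Real.exp (-⟪u0, ξ⟫)) ∂(Measure.sum M) := by
          apply lintegral_mono_ae
          filter_upwards [ae_mem hsupp] with x hx
          have h2 : (2 : ℝ≥0∞) = ENNReal.ofReal 2 := by simp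
          rw [h2, ← ENNReal.ofReal_mul (by norm_num)]
          apply ENNReal.ofReal_le_ofReal
          have hx1 := hu0n x hx
          have hp := Real.exp_pos (-⟪u0, x⟫)
          have hs := norm_nonneg x
          have hq : Real.exp (-⟪u0, x⟫) * (1 + ⟪u0, x⟫) ≤ 1 := by
            have := Real.add_one_le_exp ⟪u0, x⟫
            calc _ ≤ Real.exp (-⟪u0, x⟫) * Real.exp ⟪u0, x⟫ := by gcongr; linarith
              _ = 1 := by rw [← Real.exp_add]; simp
          rcases le_total ‖x‖ 1 with hl | hl
          · rw [min_eq_left hl]; nlinarith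
          · rw [min_eq_right hl]; nlinarith
      _ = 2 * ∫⁻ ξ, ENNReal.ofReal (1 - Real.exp (-⟪u0, ξ⟫)) ∂(Measure.sum M) := by
          rw [lintegral_const_mul' _ _ (by simp)]
      _ < ⊤ := by
          rw [key u0 hu0, ← ofReal_integral_eq_lintegral_ofReal (hint u0 hu0) (hnn u0 hu0)]
          exact ENNReal.mul_lt_top (by simp) ENNReal.ofReal_lt_top
  refine ⟨Measure.sum M, hLM, fun u hu => ?_⟩
  have hi : Integrable (fun ξ => 1 - Real.exp (-⟪u, ξ⟫)) (Measure.sum M) := by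
    refine (hLM.integrable hu).neg.congr (Eventually.of_forall fun x => ?_)
    simp
  have hi0 : 0 ≤ᵐ[Measure.sum M] (fun ξ => 1 - Real.exp (-⟪u, ξ⟫)) := by
    filter_upwards [ae_mem hsupp] with x hx
    have : Real.exp (-⟪u, x⟫) ≤ 1 := by
      rw [Real.exp_le_one_iff]; linarith [dual_nonneg hu hx]
    simpa using this
  have e : ∫ ξ, (1 - Real.exp (-⟪u, ξ⟫)) ∂(Measure.sum M) =
      ∫ ξ, (Real.exp (-⟪ψ 0, ξ⟫) - Real.exp (-⟪ψ u, ξ⟫)) ∂m := by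
    rw [integral_eq_lintegral_of_nonneg_ae hi0 hi.aestronglyMeasurable,
      integral_eq_lintegral_of_nonneg_ae (hnn u hu) (hint u hu).aestronglyMeasurable, key u hu]
  rw [← integral_sub (hm.integrable (h.maps hu)) (hm.integrable (h.maps h0))]
  have e1 : ∫ ξ, (Real.exp (-⟪u, ξ⟫) - 1) ∂(Measure.sum M) =
      -∫ ξ, (1 - Real.exp (-⟪u, ξ⟫)) ∂(Measure.sum M) := by
    rw [← integral_neg]; congr 1; funext x; ring
  rw [e1, e, ← integral_neg]
  congr 1; funext x; ring

lemma memC_comp {K : Set V} (hK : IsProperConvexCone K) {φ : V → ℝ} {ψ : V → V}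
    (hφ : MemC K φ) (h : MemCS K ψ) : MemC K (fun u => φ (ψ u)) := by
  obtain ⟨b, hb, c, hc, m, h1, h2, h3⟩ := hφ
  have hm : LM K m := ⟨h1, h2⟩
  obtain ⟨b', hb', c', hc', m', k1, k2, k3⟩ := h b hb
  have hm' : LM K m' := ⟨k1, k2⟩
  obtain ⟨M, hM, hM'⟩ := comp_levy hK h hm
  have h0 := hm.nonpos (h.maps (zero_mem_dual K))
  refine ⟨b', hb', c + c' - ∫ ξ, (Real.exp (-⟪ψ 0, ξ⟫) - 1) ∂m, by linarith, m' + M,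
    by simp [k1, hM.supp], ?_, fun u hu => ?_⟩
  · rw [lintegral_add_measure]
    exact ENNReal.add_lt_top.2 ⟨k2, hM.fin⟩
  · beta_reduce
    rw [integral_add_measure (hm'.integrable hu) (hM.integrable hu), hM' u hu,
      h3 _ (h.maps hu), real_inner_comm (ψ u) b]
    have := k3 u hu
    simp only at this
    rw [this]
    ring

end Helpers

/-- Every `ψ ∈ 𝒞_S` maps `K*` into `K*`, and `𝒞` and `𝒞_S` are closed
under composition: `φ ∈ 𝒞` and `ψ ∈ 𝒞_S` imply `φ ∘ ψ ∈ 𝒞`, while `ψ, ψ₁ ∈ 𝒞_S`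
imply `ψ₁ ∘ ψ ∈ 𝒞_S`. -/
theorem classC_CS_composition
    {V : Type*} [NormedAddCommGroup V] [InnerProductSpace ℝ V] [FiniteDimensional ℝ V]
    [MeasurableSpace V] [BorelSpace V]
    (K : Set V) (hK : IsProperConvexCone K) :
    (∀ ψ : V → V, MemCS K ψ → ∀ u ∈ dualCone K, ψ u ∈ dualCone K) ∧
    (∀ (φ : V → ℝ) (ψ : V → V), MemC K φ → MemCS K ψ → MemC K (fun u => φ (ψ u))) ∧
    (∀ (ψ ψ₁ : V → V), MemCS K ψ → MemCS K ψ₁ → MemCS K (fun u => ψ₁ (ψ u))) := by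
  have hcomp : ∀ (φ : V → ℝ) (ψ : V → V), MemC K φ → MemCS K ψ →
      MemC K (fun u => φ (ψ u)) := fun φ ψ hφ hψ => memC_comp hK hφ hψ
  refine ⟨fun ψ hψ u hu => hψ.maps hu, hcomp, fun ψ ψ₁ hψ hψ₁ x hx => ?_⟩
  exact hcomp (fun v => ⟪ψ₁ v, x⟫) ψ (hψ₁ x hx) hψ
end
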